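/- arXiv:2402.12268 — 2 statements merged into one kernel-verified Lean document; each statement's English description precedes it below -/
import Mathlib

section
/- For every positive integer d there exists v = v(d) > 0, and for every integer p ≥ d+1 there exists an integer r = r(p,d), such that the following holds. Let F be a finite family of convex sets in ℝ^d, each of Lebesgue measure at least 1, such that among any p members of F there exist d+1 whose intersection has Lebesgue measure at least 1. Then there exists a family T of at most r convex bodies in ℝ^d, each of Lebesgue measure at least v, such that every member of F contains at least one element of T. -/
open MeasureTheory

section

open Finset

theorem sum_prod_eq_one {ι β : Type*} [Fintype ι] [Fintype β] [DecidableEq β] (w : ι → ℝ)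
    (hs : ∑ i, w i = 1) : ∑ f : β → ι, ∏ j, w (f j) = 1 := by
  have := Finset.prod_univ_sum (fun _ : β => (univ : Finset ι)) (fun _ i => w i)
  simp only [hs, prod_const_one, Fintype.piFinset_univ] at this
  exact this.symm

theorem exists_le_of_forall_resample {ι X α κ γ : Type*} [Fintype ι] [Fintype α] [Fintype κ]
    [DecidableEq κ] [Fintype γ] [Nonempty γ] (w : ι → ℝ) (hw : ∀ i, 0 ≤ w i) (hs : ∑ i, w i = 1)
    (M : ℕ) (hM : 0 < M)
    (N : (α → ι) → γ → X) (Rel : X → (κ → ι) → Prop) [∀ x g, Decidable (Rel x g)]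
    (h : ∀ f : Fin M → ι, ∃ τ : α → Fin M, ∃ ρ : κ → Fin M, Function.Injective ρ ∧
      (∀ a b, τ a ≠ ρ b) ∧ ∃ c, Rel (N (f ∘ τ) c) (f ∘ ρ)) :
    ∃ x, 1 / ((M : ℝ) ^ (Fintype.card α + Fintype.card κ) * Fintype.card γ) ≤
      ∑ g : κ → ι, if Rel x g then ∏ i, w (g i) else 0 := by
  classical
  set δ : ℝ := 1 / ((M : ℝ) ^ (Fintype.card α + Fintype.card κ) * Fintype.card γ) with hδ
  have hγ : (0 : ℝ) < Fintype.card γ := by exact_mod_cast Fintype.card_pos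
  have hM' : (0 : ℝ) < M := by exact_mod_cast hM
  by_contra! hlt
  have key : ∀ q : (α → Fin M) × (κ → Fin M) × γ,
      ∑ f : Fin M → ι, (if (Function.Injective q.2.1 ∧ (∀ a b, q.1 a ≠ q.2.1 b) ∧
        Rel (N (f ∘ q.1) q.2.2) (f ∘ q.2.1)) then ∏ j, w (f j) else 0) < δ := by
    rintro ⟨τ, ρ, c⟩
    have hδ0 : 0 < δ := by positivity
    by_cases hρ : Function.Injective ρ ∧ ∀ a b, τ a ≠ ρ b
    swap
    · rw [Finset.sum_eq_zero]
      · exact hδ0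
      · intro f _
        rw [if_neg]
        rintro ⟨h1, h2, -⟩
        exact hρ ⟨h1, h2⟩
    obtain ⟨hinj, hdis⟩ := hρ
    simp only [hinj, true_and]
    let e : κ ⊕ {j // ¬ j ∈ Set.range ρ} ≃ Fin M :=
      (Equiv.sumCongr (Equiv.ofInjective ρ hinj) (Equiv.refl _)).trans
        (Equiv.sumCompl (fun j => j ∈ Set.range ρ))
    have e1 : ∀ i, e (Sum.inl i) = ρ i := fun i => rfl
    have e2 : ∀ j, e (Sum.inr j) = j.1 := fun i => rfl
    let E : (κ → ι) × ({j // ¬ j ∈ Set.range ρ} → ι) ≃ (Fin M → ι) :=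
      (Equiv.sumArrowEquivProdArrow _ _ _).symm.trans (Equiv.arrowCongr e (Equiv.refl ι))
    have E1 : ∀ g u i, E (g, u) (ρ i) = g i := by
      intro g u i
      simp [E, Equiv.arrowCongr, ← e1]
    have E2 : ∀ g u j, E (g, u) (j : {j // ¬ j ∈ Set.range ρ}).1 = u j := by
      intro g u i
      simp [E, Equiv.arrowCongr, ← e2]
    rw [← E.sum_comp, Fintype.sum_prod_type_right]
    have hW : ∀ g u, ∏ j, w (E (g, u) j) = (∏ i, w (g i)) * ∏ j, w (u j) := by
      intro g u
      rw [← e.prod_comp, Fintype.prod_sum_type]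
      simp only [e1, e2, E1, E2]
    have hτ : ∀ g u, E (g, u) ∘ τ = fun a => u ⟨τ a, fun ⟨b, hb⟩ => hdis a b hb.symm⟩ := by
      intro g u
      funext a
      exact E2 g u ⟨τ a, fun ⟨b, hb⟩ => hdis a b hb.symm⟩
    have hρ : ∀ g u, E (g, u) ∘ ρ = g := by
      intro g u
      funext a
      exact E1 g u a
    simp only [hW, hτ, hρ]
    have : ∀ u : {j // ¬ j ∈ Set.range ρ} → ι,
        (∑ g : κ → ι, if ((∀ a b, τ a ≠ ρ b) ∧
          Rel (N (fun a => u ⟨τ a, fun ⟨b, hb⟩ => hdis a b hb.symm⟩) c) g) then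
            (∏ i, w (g i)) * ∏ j, w (u j) else 0) =
        (∏ j, w (u j)) * ∑ g : κ → ι, if
          Rel (N (fun a => u ⟨τ a, fun ⟨b, hb⟩ => hdis a b hb.symm⟩) c) g then
            (∏ i, w (g i)) else 0 := by
      intro u
      rw [Finset.mul_sum]
      refine Finset.sum_congr rfl fun g _ => ?_
      have hd : (∀ a b, τ a ≠ ρ b) := hdis
      simp only [hd, true_and, implies_true, not_false_eq_true, ne_eq]
      split_ifs <;> ring
    simp only [this]
    have tot := sum_prod_eq_one (β := {j // ¬ j ∈ Set.range ρ}) w hs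
    have hnn : ∀ u : {j // ¬ j ∈ Set.range ρ} → ι, 0 ≤ ∏ j, w (u j) :=
      fun u => prod_nonneg fun j _ => hw _
    calc _ < ∑ u : {j // ¬ j ∈ Set.range ρ} → ι, (∏ j, w (u j)) * δ := by
          refine Finset.sum_lt_sum (fun u _ => mul_le_mul_of_nonneg_left (hlt _).le (hnn u)) ?_
          obtain ⟨u, -, hu⟩ : ∃ u ∈ (univ : Finset ({j // ¬ j ∈ Set.range ρ} → ι)),
              0 < ∏ j, w (u j) := by
            by_contra! hcon
            have := Finset.sum_nonpos hcon
            linarith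
          exact ⟨u, mem_univ _, mul_lt_mul_of_pos_left (hlt _) hu⟩
      _ = δ := by rw [← Finset.sum_mul, tot, one_mul]
  have hle : (1 : ℝ) ≤ ∑ q : (α → Fin M) × (κ → Fin M) × γ,
      ∑ f : Fin M → ι, (if (Function.Injective q.2.1 ∧ (∀ a b, q.1 a ≠ q.2.1 b) ∧
        Rel (N (f ∘ q.1) q.2.2) (f ∘ q.2.1)) then ∏ j, w (f j) else 0) := by
    rw [Finset.sum_comm, ← sum_prod_eq_one (β := Fin M) w hs]
    refine Finset.sum_le_sum fun f _ => ?_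
    obtain ⟨τ, ρ, h1, h2, c, h3⟩ := h f
    have hnn : (0 : ℝ) ≤ ∏ j, w (f j) := prod_nonneg fun j _ => hw _
    refine le_trans ?_ (Finset.single_le_sum (f := fun q : (α → Fin M) × (κ → Fin M) × γ =>
      (if (Function.Injective q.2.1 ∧ (∀ a b, q.1 a ≠ q.2.1 b) ∧
        Rel (N (f ∘ q.1) q.2.2) (f ∘ q.2.1)) then ∏ j, w (f j) else 0))
      (fun q _ => by split_ifs <;> simp [hnn]) (mem_univ (τ, ρ, c)))
    rw [if_pos ⟨h1, h2, h3⟩]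
  have : (1 : ℝ) < ∑ q : (α → Fin M) × (κ → Fin M) × γ, δ := by
    refine lt_of_le_of_lt hle (Finset.sum_lt_sum_of_nonempty ?_ fun q _ => key q)
    have : Nonempty (Fin M) := ⟨⟨0, hM⟩⟩
    exact Finset.univ_nonempty
  rw [Finset.sum_const, card_univ, nsmul_eq_mul, hδ] at this
  simp only [Fintype.card_prod, Fintype.card_fun, Fintype.card_fin] at this
  push_cast at this
  rw [pow_add] at this
  have h0 : ((M : ℝ) ^ Fintype.card α * (M ^ Fintype.card κ * Fintype.card γ)) *
    (1 / (M ^ Fintype.card α * M ^ Fintype.card κ * Fintype.card γ)) = 1 := by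
    field_simp
  linarith

end

theorem exists_ramsey_number (k a b : ℕ) : ∃ N : ℕ, ∀ (α : Type) [DecidableEq α] (s : Finset α)
    (R : Finset α → Prop), N ≤ s.card →
      (∃ t ⊆ s, t.card = a ∧ ∀ u ⊆ t, u.card = k → R u) ∨
      (∃ t ⊆ s, t.card = b ∧ ∀ u ⊆ t, u.card = k → ¬ R u) := by
  induction k generalizing a b with
  | zero =>
    refine ⟨max a b, fun α _ s R hN => ?_⟩
    by_cases h : R ∅
    · obtain ⟨t, ht, hc⟩ := Finset.exists_subset_card_eq (le_trans (le_max_left a b) hN)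
      exact Or.inl ⟨t, ht, hc, fun u _ hu => by rwa [Finset.card_eq_zero.1 hu]⟩
    · obtain ⟨t, ht, hc⟩ := Finset.exists_subset_card_eq (le_trans (le_max_right a b) hN)
      exact Or.inr ⟨t, ht, hc, fun u _ hu => by rwa [Finset.card_eq_zero.1 hu]⟩
  | succ k ih =>
    induction a generalizing b with
    | zero =>
      refine ⟨0, fun α _ s R _ => Or.inl ⟨∅, by simp, rfl, fun u hu hc => ?_⟩⟩
      simp [Finset.subset_empty.1 hu] at hc
    | succ a iha =>
      induction b with
      | zero =>
        refine ⟨0, fun α _ s R _ => Or.inr ⟨∅, by simp, rfl, fun u hu hc => ?_⟩⟩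
        simp [Finset.subset_empty.1 hu] at hc
      | succ b ihb =>
        obtain ⟨n₁, h₁⟩ := iha (b + 1)
        obtain ⟨n₂, h₂⟩ := ihb
        obtain ⟨n, hn⟩ := ih n₁ n₂
        have ext : ∀ (α : Type) [DecidableEq α] (x : α) (t : Finset α) (Q : Finset α → Prop),
            x ∉ t → (∀ u ⊆ t, u.card = k → Q (insert x u)) →
            (∀ u ⊆ t, u.card = k + 1 → Q u) → ∀ u ⊆ insert x t, u.card = k + 1 → Q u := by
          intro α _ x t Q hx hQ hQ' u hu hc
          by_cases hxu : x ∈ u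
          · rw [← Finset.insert_erase hxu]
            refine hQ _ ?_ ?_
            · rwa [← Finset.subset_insert_iff]
            · rw [Finset.card_erase_of_mem hxu, hc]; rfl
          · exact hQ' u ((Finset.subset_insert_iff_of_notMem hxu).1 hu) hc
        refine ⟨n + 1, fun α _ s R hN => ?_⟩
        obtain ⟨x, hx⟩ : s.Nonempty := Finset.card_pos.1 (by omega)
        have hc : n ≤ (s.erase x).card := by rw [Finset.card_erase_of_mem hx]; omega
        have hes := Finset.erase_subset x s
        rcases hn α (s.erase x) (fun u => R (insert x u)) hc with
          ⟨t, ht, htc, htR⟩ | ⟨t, ht, htc, htR⟩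
        · rcases h₁ α t R htc.ge with ⟨t', ht', htc', hR'⟩ | ⟨t', ht', htc', hR'⟩
          · have hxt : x ∉ t' := fun h => Finset.notMem_erase x s (ht (ht' h))
            refine Or.inl ⟨insert x t', ?_, ?_, ?_⟩
            · exact Finset.insert_subset hx ((ht'.trans ht).trans hes)
            · rw [Finset.card_insert_of_notMem hxt, htc']
            · exact ext α x t' R hxt (fun u hu => htR u (hu.trans ht')) hR'
          · exact Or.inr ⟨t', (ht'.trans ht).trans hes, htc', hR'⟩
        · rcases h₂ α t R htc.ge with ⟨t', ht', htc', hR'⟩ | ⟨t', ht', htc', hR'⟩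
          · exact Or.inl ⟨t', (ht'.trans ht).trans hes, htc', hR'⟩
          · have hxt : x ∉ t' := fun h => Finset.notMem_erase x s (ht (ht' h))
            refine Or.inr ⟨insert x t', ?_, ?_, ?_⟩
            · exact Finset.insert_subset hx ((ht'.trans ht).trans hes)
            · rw [Finset.card_insert_of_notMem hxt, htc']
            · exact ext α x t' (fun u => ¬ R u) hxt (fun u hu => htR u (hu.trans ht')) hR'

theorem exists_subset_image_injOn {α β : Type*} [DecidableEq β] (T : Finset α) (z : α → β) :
    ∃ T' ⊆ T, T'.image z = T.image z ∧ Set.InjOn z T' := by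
  obtain ⟨T', hT', hbij⟩ := Set.SurjOn.exists_bijOn_subset (Set.surjOn_image z (T : Set α))
  have hfin : T'.Finite := T.finite_toSet.subset hT'
  refine ⟨hfin.toFinset, ?_, ?_, ?_⟩
  · intro x hx
    exact hT' (hfin.mem_toFinset.1 hx)
  · apply Finset.coe_injective
    rw [Finset.coe_image, Finset.coe_image, hfin.coe_toFinset]
    exact hbij.image_eq
  · rw [hfin.coe_toFinset]
    exact hbij.injOn

theorem exists_disjoint_groups {E : Type*} [NormedAddCommGroup E] [InnerProductSpace ℝ E]
    [FiniteDimensional ℝ E] {D : ℕ} (hD : Module.finrank ℝ E = D) {M : ℕ}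
    (hM : (D + 1) * (D * (D + 1)) < M) (z : Fin M → E) :
    ∃ σ : Fin (D + 1) → Fin (D + 1) → Fin M, (∀ s i t j, σ s i = σ t j → s = t ∧ i = j) ∧
      ∃ c, ∀ t, c ∈ convexHull ℝ (Set.range (z ∘ σ t)) := by
  classical
  obtain ⟨c, hc⟩ : ∃ c, ∀ S : Finset (Fin M), Sᶜ.card ≤ D * (D + 1) →
      c ∈ convexHull ℝ (z '' (S : Set (Fin M))) := by
    let I : Finset (Finset (Fin M)) := Finset.univ.filter fun S => Sᶜ.card ≤ D * (D + 1)
    obtain ⟨c, hc⟩ := Convex.helly_theorem' (𝕜 := ℝ) (s := I)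
      (F := fun S : Finset (Fin M) => convexHull ℝ (z '' (S : Set (Fin M))))
      (fun S _ => convex_convexHull ℝ _) (by
        intro I' hI' hcard
        rw [hD] at hcard
        have h1 : (I'.biUnion fun S : Finset (Fin M) => Sᶜ).card < M := by
          refine lt_of_le_of_lt (Finset.card_biUnion_le_card_mul _ _ (D * (D + 1)) ?_) ?_
          · intro S hS
            exact (Finset.mem_filter.1 (hI' hS)).2
          · exact lt_of_le_of_lt (Nat.mul_le_mul_right _ hcard) hM
        obtain ⟨i, hi⟩ : ∃ i, i ∉ I'.biUnion fun S : Finset (Fin M) => Sᶜ := by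
          by_contra! hcon
          have : I'.biUnion (fun S : Finset (Fin M) => Sᶜ) = Finset.univ :=
            Finset.eq_univ_of_forall hcon
          rw [this, Finset.card_univ, Fintype.card_fin] at h1
          exact lt_irrefl _ h1
        refine ⟨z i, Set.mem_iInter₂.2 fun S hS => subset_convexHull ℝ _ ⟨i, ?_, rfl⟩⟩
        by_contra hcon
        exact hi (Finset.mem_biUnion.2 ⟨S, hS, Finset.mem_compl.2 hcon⟩))
    exact ⟨c, fun S hS => Set.mem_iInter₂.1 hc S (Finset.mem_filter.2 ⟨Finset.mem_univ _, hS⟩)⟩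
  have hMD : (D + 1) * (D + 1) ≤ M := by
    rcases Nat.eq_zero_or_pos D with rfl | hpos
    · omega
    · nlinarith [Nat.mul_le_mul hpos (le_refl ((D+1)*(D+1)))]
  have step : ∀ n ≤ D + 1, ∃ σ : Fin n → Fin (D + 1) → Fin M,
      (∀ s i t j, σ s i = σ t j → s = t ∧ i = j) ∧
      ∀ t, c ∈ convexHull ℝ (Set.range (z ∘ σ t)) := by
    intro n
    induction n with
    | zero => exact fun _ => ⟨fun s => s.elim0, fun s => s.elim0, fun s => s.elim0⟩
    | succ n ih =>
      intro hn
      obtain ⟨σ, hσ, hcσ⟩ := ih (by omega)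
      let S : Finset (Fin M) := (Finset.univ.image fun q : Fin n × Fin (D + 1) => σ q.1 q.2)ᶜ
      have hScard : Sᶜ.card = n * (D + 1) := by
        rw [compl_compl, Finset.card_image_of_injective]
        · simp
        · rintro ⟨a, b⟩ ⟨a', b'⟩ h
          obtain ⟨h1, h2⟩ := hσ _ _ _ _ h
          exact Prod.ext h1 h2
      have hS := hc S (by rw [hScard]; exact Nat.mul_le_mul_right _ (by omega))
      have hS2 : D + 1 ≤ S.card := by
        have := Finset.card_add_card_compl S
        rw [hScard, Fintype.card_fin] at this
        have : n * (D + 1) ≤ D * (D + 1) := Nat.mul_le_mul_right _ (by omega)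
        nlinarith
      rw [convexHull_eq_union] at hS
      simp only [Set.mem_iUnion] at hS
      obtain ⟨t, ht, hind, hct⟩ := hS
      have htc : t.card ≤ D + 1 := by
        have := hind.card_le_finrank_succ
        rw [Fintype.card_coe] at this
        have h2 : Module.finrank ℝ (vectorSpan ℝ (Set.range ((↑) : t → E))) ≤ D :=
          hD ▸ Submodule.finrank_le _
        omega
      obtain ⟨T, hTS, hT⟩ := Finset.subset_set_image_iff.1 ht
      obtain ⟨T', hT', hT'z, hT'inj⟩ : ∃ T' ⊆ T, T'.image z = t ∧ T'.card = t.card := by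
        obtain ⟨T', hT', h1, h2⟩ := exists_subset_image_injOn T z
        exact ⟨T', hT', h1.trans hT, by rw [← hT, ← h1, Finset.card_image_of_injOn h2]⟩
      obtain ⟨U, hT'U, hUS, hU⟩ := Finset.exists_subsuperset_card_eq
        (hT'.trans (Finset.coe_subset.1 hTS)) (by omega) hS2
      let e := (U.equivFinOfCardEq hU).symm
      have hUd : ∀ i s j, σ s j ≠ (e i : Fin M) := by
        intro i s j h
        have := hUS (e i).2
        rw [Finset.mem_compl] at this
        exact this (Finset.mem_image.2 ⟨(s, j), Finset.mem_univ _, h⟩)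
      refine ⟨Fin.snoc σ fun i => (e i : Fin M), ?_, ?_⟩
      · intro s i t j
        refine Fin.lastCases ?_ (fun s => ?_) s <;> refine Fin.lastCases ?_ (fun t => ?_) t
        · simp only [Fin.snoc_last, true_and]
          intro h
          exact e.injective (Subtype.ext h)
        · simp only [Fin.snoc_last, Fin.snoc_castSucc]
          intro h
          exact absurd h.symm (hUd _ _ _)
        · simp only [Fin.snoc_last, Fin.snoc_castSucc]
          intro h
          exact absurd h (hUd _ _ _)
        · simp only [Fin.snoc_castSucc]
          intro h
          obtain ⟨h1, h2⟩ := hσ _ _ _ _ h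
          exact ⟨by rw [h1], h2⟩
      · intro s
        refine Fin.lastCases ?_ (fun s => ?_) s
        · simp only [Fin.snoc_last]
          refine convexHull_mono ?_ hct
          intro x hx
          rw [← hT'z] at hx
          obtain ⟨i, hi, rfl⟩ := Finset.mem_image.1 (Finset.mem_coe.1 hx)
          exact ⟨e.symm ⟨i, hT'U hi⟩, by simp⟩
        · simpa only [Fin.snoc_castSucc] using hcσ s
  obtain ⟨σ, h1, h2⟩ := step (D + 1) le_rfl
  exact ⟨σ, h1, c, h2⟩

/-- A point of minimal norm of `A`. -/
noncomputable def minNormPoint {E : Type*} [NormedAddCommGroup E] (A : Set E) : E :=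
  Classical.epsilon fun x => x ∈ A ∧ ∀ y ∈ A, ‖x‖ ≤ ‖y‖

theorem minNormPoint_spec {E : Type*} [NormedAddCommGroup E] {A : Set E} (hA : IsCompact A)
    (hne : A.Nonempty) : minNormPoint A ∈ A ∧ ∀ y ∈ A, ‖minNormPoint A‖ ≤ ‖y‖ := by
  obtain ⟨x, hx, hmin⟩ := hA.exists_isMinOn hne continuous_norm.continuousOn
  exact Classical.epsilon_spec (p := fun x => x ∈ A ∧ ∀ y ∈ A, ‖x‖ ≤ ‖y‖)
    ⟨x, hx, fun y hy => hmin hy⟩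

theorem eq_of_minimal_norm {E : Type*} [NormedAddCommGroup E] [InnerProductSpace ℝ E] {A : Set E}
    (hA : Convex ℝ A) {x y : E} (hx : x ∈ A) (hy : y ∈ A) (hmin : ∀ z ∈ A, ‖x‖ ≤ ‖z‖)
    (hxy : ‖y‖ ≤ ‖x‖) : y = x := by
  have hm : (1 / 2 : ℝ) • x + (1 / 2 : ℝ) • y ∈ A :=
    hA hx hy (by norm_num) (by norm_num) (by norm_num)
  have h1 := hmin _ hm
  rw [← smul_add, norm_smul] at h1
  have h2 := parallelogram_law_with_norm ℝ x y
  have h3 : ‖x - y‖ = 0 := by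
    have hn : ‖(1 / 2 : ℝ)‖ = 1 / 2 := by norm_num
    rw [hn] at h1
    have := norm_nonneg (x - y)
    have := norm_nonneg x
    have := norm_nonneg y
    have : ‖x - y‖ * ‖x - y‖ ≤ 0 := by nlinarith
    nlinarith
  exact (sub_eq_zero.1 (norm_eq_zero.1 h3)).symm

theorem IsCompact.iInter_of_nonempty {X ι : Type*} [TopologicalSpace X] [T2Space X] [Nonempty ι]
    {C : ι → Set X} (hC : ∀ i, IsCompact (C i)) : IsCompact (⋂ i, C i) :=
  (hC (Classical.arbitrary ι)).of_isClosed_subset (isClosed_iInter fun i => (hC i).isClosed)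
    (Set.iInter_subset _ _)

theorem exists_minNormPoint_mem {E : Type*} [NormedAddCommGroup E] [InnerProductSpace ℝ E]
    [FiniteDimensional ℝ E] {D : ℕ} (hD : Module.finrank ℝ E = D) (C : Fin (D + 1) → Set E)
    (hconv : ∀ t, Convex ℝ (C t)) (hcomp : ∀ t, IsCompact (C t)) (hne : (⋂ t, C t).Nonempty) :
    ∃ t, minNormPoint (⋂ s : Fin D, C (t.succAbove s)) ∈ C t := by
  classical
  rcases Nat.eq_zero_or_pos D with rfl | hpos
  · obtain ⟨c, hc⟩ := hne
    have := Module.finrank_zero_iff.1 hD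
    refine ⟨0, ?_⟩
    rw [Subsingleton.elim (minNormPoint _) c]
    exact Set.mem_iInter.1 hc 0
  have hcI : IsCompact (⋂ t, C t) := IsCompact.iInter_of_nonempty hcomp
  obtain ⟨hI, hImin⟩ := minNormPoint_spec hcI hne
  set xI := minNormPoint (⋂ t, C t)
  have : Nonempty (Fin D) := ⟨⟨0, hpos⟩⟩
  have hcG : ∀ t : Fin (D + 1), IsCompact (⋂ s : Fin D, C (t.succAbove s)) :=
    fun t => IsCompact.iInter_of_nonempty fun s => hcomp _
  have hsub : ∀ t : Fin (D + 1), (⋂ t, C t) ⊆ (⋂ s : Fin D, C (t.succAbove s)) :=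
    fun t x hx => Set.mem_iInter.2 fun s => Set.mem_iInter.1 hx _
  have hG := fun t => minNormPoint_spec (hcG t) (hne.mono (hsub t))
  by_contra! hcon
  have hlt : ∀ t : Fin (D + 1), ‖minNormPoint (⋂ s : Fin D, C (t.succAbove s))‖ < ‖xI‖ := by
    intro t
    refine lt_of_le_of_ne ((hG t).2 _ (hsub t hI)) fun heq => hcon t ?_
    have : xI = minNormPoint (⋂ s : Fin D, C (t.succAbove s)) :=
      eq_of_minimal_norm (convex_iInter fun s => hconv _) (hG t).1 (hsub t hI) (hG t).2 heq.ge
    rw [← this]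
    exact Set.mem_iInter.1 hI t
  let F : Option (Fin (D + 1)) → Set E := fun o => o.elim (Metric.ball 0 ‖xI‖) C
  obtain ⟨y, hy⟩ := Convex.helly_theorem' (𝕜 := ℝ) (s := (Finset.univ : Finset (Option (Fin (D + 1)))))
    (F := F) (by
      rintro (_ | t) -
      · exact convex_ball _ _
      · exact hconv t) (by
      intro I _ hI'
      rw [hD] at hI'
      obtain ⟨o, ho⟩ : ∃ o, o ∉ I := by
        by_contra! hall
        rw [Finset.eq_univ_of_forall hall] at hI'
        simp at hI'
      rcases o with _ | t
      · refine ⟨xI, Set.mem_iInter₂.2 ?_⟩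
        rintro (_ | s) hs
        · exact absurd hs ho
        · exact Set.mem_iInter.1 hI s
      · refine ⟨minNormPoint (⋂ s : Fin D, C (t.succAbove s)), Set.mem_iInter₂.2 ?_⟩
        rintro (_ | s) hs
        · simpa [F] using hlt t
        · have hst : s ≠ t := by
            rintro rfl
            exact ho hs
          obtain ⟨s', rfl⟩ := Fin.exists_succAbove_eq hst
          exact Set.mem_iInter.1 (hG t).1 s')
  have hy' := fun o => Set.mem_iInter₂.1 hy o (Finset.mem_univ _)
  have h1 : ‖y‖ < ‖xI‖ := by simpa [F] using hy' none
  have h2 := hImin y (Set.mem_iInter.2 fun t => hy' (some t))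
  linarith

theorem exists_selection_const (E : Type*) [NormedAddCommGroup E] [InnerProductSpace ℝ E]
    [FiniteDimensional ℝ E] {D : ℕ} (hD : Module.finrank ℝ E = D) :
    ∃ c > (0 : ℝ), ∀ (S : Type) [Fintype S] [Nonempty S] (y : S → E), ∃ x : E,
      c * (Fintype.card S : ℝ) ^ (D + 1) ≤
        (Nat.card {g : Fin (D + 1) → S // x ∈ convexHull ℝ (Set.range (y ∘ g))} : ℝ) := by
  classical
  set M := (D + 1) * (D * (D + 1)) + 1 with hM
  refine ⟨1 / ((M : ℝ) ^ (Fintype.card (Fin D × Fin (D + 1)) + Fintype.card (Fin (D + 1))) *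
    Fintype.card Unit), by positivity, fun S _ _ y => ?_⟩
  have hS : (0 : ℝ) < Fintype.card S := by exact_mod_cast Fintype.card_pos
  obtain ⟨x, hx⟩ := exists_le_of_forall_resample (ι := S) (X := E) (α := Fin D × Fin (D + 1))
    (κ := Fin (D + 1)) (γ := Unit) (fun _ => 1 / (Fintype.card S : ℝ)) (fun _ => by positivity)
    (by simp) M (by omega)
    (fun h _ => minNormPoint (⋂ s : Fin D, convexHull ℝ (Set.range fun j => y (h (s, j)))))
    (fun x g => x ∈ convexHull ℝ (Set.range (y ∘ g))) (by
      intro f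
      obtain ⟨σ, hσ, c, hc⟩ := exists_disjoint_groups hD (M := M) (by omega) (y ∘ f)
      obtain ⟨t, ht⟩ := exists_minNormPoint_mem hD
        (fun t => convexHull ℝ (Set.range ((y ∘ f) ∘ σ t))) (fun t => convex_convexHull ℝ _)
        (fun t => (Set.finite_range _).isCompact_convexHull ℝ) ⟨c, Set.mem_iInter.2 hc⟩
      refine ⟨fun q => σ (t.succAbove q.1) q.2, σ t, fun i j h => (hσ _ _ _ _ h).2, ?_, (), ?_⟩
      · rintro ⟨a, b⟩ j h
        exact Fin.succAbove_ne _ _ (hσ _ _ _ _ h).1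
      · exact ht)
  refine ⟨x, ?_⟩
  rw [Nat.card_eq_fintype_card, Fintype.card_subtype]
  rw [← Finset.sum_filter, Finset.sum_const, nsmul_eq_mul] at hx
  simp only [Finset.prod_const, Finset.card_univ, one_div, inv_pow] at hx ⊢
  rw [← div_eq_mul_inv, le_div_iff₀ (by positivity)] at hx
  simpa using hx

theorem exists_points_of_fractional {E ι : Type*} [Fintype ι] [Nonempty ι] (K : ι → Set E)
    [∀ (x : E) i, Decidable (x ∈ K i)] {β : ℝ} (hβ : 0 < β)
    (h : ∀ w : ι → ℝ, (∀ i, 0 ≤ w i) → ∑ i, w i = 1 → ∃ x, β ≤ ∑ i, if x ∈ K i then w i else 0) :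
    ∃ L : ℕ, 0 < L ∧ ∃ y : Fin L → E, ∀ i,
      β / 4 * L ≤ ((Finset.univ.filter fun s => y s ∈ K i).card : ℝ) := by
  have step : ∀ L : ℕ, ∃ y : Fin L → E,
      ∑ i, ∏ s, (if y s ∈ K i then (1 / 2 : ℝ) else 1) ≤ Fintype.card ι * (1 - β / 2) ^ L := by
    intro L
    induction L with
    | zero => exact ⟨fun s => s.elim0, by simp⟩
    | succ L ih =>
      obtain ⟨y, hy⟩ := ih
      set W : ι → ℝ := fun i => ∏ s, (if y s ∈ K i then (1 / 2 : ℝ) else 1) with hW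
      have hWpos : ∀ i, 0 < W i := fun i => Finset.prod_pos fun s _ => by split_ifs <;> norm_num
      have hsum : 0 < ∑ i, W i := Finset.sum_pos (fun i _ => hWpos i) Finset.univ_nonempty
      obtain ⟨x, hx⟩ := h (fun i => W i / ∑ i, W i) (fun i => by have := hWpos i; positivity)
        (by rw [← Finset.sum_div, div_self hsum.ne'])
      have hx' : β * ∑ i, W i ≤ ∑ i, if x ∈ K i then W i else 0 := by
        rw [← le_div_iff₀ hsum, Finset.sum_div]
        refine hx.trans (Finset.sum_le_sum fun i _ => ?_)
        split_ifs <;> simp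
      have hβ1 : β ≤ 1 := by
        have : (∑ i, if x ∈ K i then W i else 0) ≤ ∑ i, W i :=
          Finset.sum_le_sum fun i _ => by split_ifs <;> simp [(hWpos i).le]
        have : β * ∑ i, W i ≤ 1 * ∑ i, W i := by linarith
        exact le_of_mul_le_mul_right this hsum
      refine ⟨Fin.snoc y x, ?_⟩
      have : ∀ i, ∏ s, (if (Fin.snoc y x : Fin (L + 1) → E) s ∈ K i then (1 / 2 : ℝ) else 1) =
          W i - 1 / 2 * (if x ∈ K i then W i else 0) := by
        intro i
        rw [Fin.prod_univ_castSucc]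
        simp only [Fin.snoc_castSucc, Fin.snoc_last, hW]
        split_ifs <;> ring
      simp only [this]
      rw [Finset.sum_sub_distrib, ← Finset.mul_sum, pow_succ]
      have : (∑ i, W i) * (1 - β / 2) ≤ Fintype.card ι * (1 - β / 2) ^ L * (1 - β / 2) :=
        mul_le_mul_of_nonneg_right hy (by linarith)
      linarith
  have hn : (0 : ℝ) < Fintype.card ι := by exact_mod_cast Fintype.card_pos
  obtain ⟨L, hL⟩ := exists_nat_ge (4 * Real.log (Fintype.card ι) / β)
  refine ⟨L + 1, by omega, ?_⟩
  obtain ⟨y, hy⟩ := step (L + 1)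
  refine ⟨y, fun i => ?_⟩
  set c := (Finset.univ.filter fun s => y s ∈ K i).card
  have h1 : (1 / 2 : ℝ) ^ c ≤ Fintype.card ι * (1 - β / 2) ^ (L + 1) := by
    refine le_trans ?_ (le_trans (Finset.single_le_sum
      (f := fun i => ∏ s, (if y s ∈ K i then (1 / 2 : ℝ) else 1)) (fun i _ =>
      Finset.prod_nonneg fun s _ => by split_ifs <;> norm_num) (Finset.mem_univ i)) hy)
    rw [Finset.prod_ite]
    simp [c]
  have hβ1 : 0 ≤ 1 - β / 2 := by
    obtain ⟨x, hx⟩ := h (fun i => 1 / Fintype.card ι) (fun i => by positivity) (by simp)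
    have : (∑ i, if x ∈ K i then 1 / (Fintype.card ι : ℝ) else 0) ≤
        ∑ i : ι, 1 / (Fintype.card ι : ℝ) :=
      Finset.sum_le_sum fun i _ => by split_ifs <;> simp
    simp at this
    simp at hx
    linarith
  have h2 : Real.exp (-c) ≤ Real.exp (Real.log (Fintype.card ι) - β / 2 * (L + 1)) := by
    calc Real.exp (-c) = Real.exp (-1) ^ c := by rw [← Real.exp_nat_mul]; ring_nf
      _ ≤ (1 / 2) ^ c := by
        gcongr
        rw [Real.exp_neg, one_div]
        gcongr
        have := Real.add_one_le_exp (1 : ℝ)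
        linarith
      _ ≤ _ := h1
      _ ≤ Fintype.card ι * Real.exp (-(β / 2)) ^ (L + 1) := by
        gcongr
        have := Real.add_one_le_exp (-(β / 2))
        linarith
      _ = _ := by
        rw [sub_eq_add_neg, Real.exp_add, Real.exp_log hn, ← Real.exp_nat_mul]
        push_cast
        ring_nf
  rw [Real.exp_le_exp] at h2
  rw [div_le_iff₀ hβ] at hL
  push_cast
  nlinarith

theorem exists_net_size (E : Type*) [NormedAddCommGroup E] [InnerProductSpace ℝ E]
    [FiniteDimensional ℝ E] {ε : ℝ} (hε : 0 < ε) :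
    ∃ r : ℕ, ∀ (S : Type) [Fintype S] [Nonempty S] (y : S → E) (ι : Type) (K : ι → Set E)
      [∀ (x : E) i, Decidable (x ∈ K i)],
      (∀ i, Convex ℝ (K i)) →
      (∀ i, ε * Fintype.card S ≤ ((Finset.univ.filter fun s => y s ∈ K i).card : ℝ)) →
      ∃ N : Finset E, N.card ≤ r ∧ ∀ i, ∃ x ∈ N, x ∈ K i := by
  classical
  obtain ⟨c, hc, hsel⟩ := exists_selection_const E rfl
  set D := Module.finrank ℝ E
  obtain ⟨r, hr⟩ := exists_nat_gt (1 / (c * ε ^ (D + 1)))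
  refine ⟨r, fun S _ _ y ι K _ hconv hK => ?_⟩
  have hS : (0 : ℝ) < Fintype.card S := by exact_mod_cast Fintype.card_pos
  by_contra! hcon
  have step : ∀ n ≤ r, ∃ N : Finset E, N.card ≤ n ∧ n * (c * (ε * Fintype.card S) ^ (D + 1)) ≤
      ((Finset.univ.filter fun g : Fin (D + 1) → S =>
        ∃ x ∈ N, x ∈ convexHull ℝ (Set.range (y ∘ g))).card : ℝ) := by
    intro n
    induction n with
    | zero => exact fun _ => ⟨∅, by simp, by simp⟩
    | succ n ih =>
      intro hn
      obtain ⟨N, hN, hcard⟩ := ih (by omega)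
      obtain ⟨i, hi⟩ := hcon N (by omega)
      let S' := {s : S // y s ∈ K i}
      have hS'card : ε * Fintype.card S ≤ Fintype.card S' := by
        rw [Fintype.card_subtype]
        exact hK i
      have hS'ne : Nonempty S' := by
        rw [← Fintype.card_pos_iff]
        have : (0 : ℝ) < Fintype.card S' := lt_of_lt_of_le (by positivity) hS'card
        exact_mod_cast this
      obtain ⟨x, hx⟩ := hsel S' (fun s => y s.1)
      refine ⟨insert x N, (Finset.card_insert_le _ _).trans (by omega), ?_⟩
      rw [Nat.card_eq_fintype_card, Fintype.card_subtype
        fun g : Fin (D + 1) → S' => x ∈ convexHull ℝ (Set.range ((fun s : S' => y s.1) ∘ g))] at hx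
      set A := Finset.univ.filter fun g : Fin (D + 1) → S =>
        ∃ x ∈ N, x ∈ convexHull ℝ (Set.range (y ∘ g)) with hA
      set B := Finset.univ.filter fun g : Fin (D + 1) → S' =>
        x ∈ convexHull ℝ (Set.range ((fun s : S' => y s.1) ∘ g))
      let B' := B.image fun g j => (g j).1
      have hB' : B'.card = B.card := Finset.card_image_of_injective _ fun g g' h => by
        funext j
        exact Subtype.ext (congrFun h j)
      have hdisj : Disjoint A B' := by
        rw [Finset.disjoint_left]
        intro g hg hg'
        obtain ⟨g', -, rfl⟩ := Finset.mem_image.1 hg'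
        obtain ⟨z, hzN, hz⟩ := (Finset.mem_filter.1 hg).2
        refine hi z hzN ((hconv i).convexHull_subset_iff.2 ?_ hz)
        rintro _ ⟨j, rfl⟩
        exact (g' j).2
      have hsub : A ∪ B' ⊆ Finset.univ.filter fun g : Fin (D + 1) → S =>
          ∃ z ∈ insert x N, z ∈ convexHull ℝ (Set.range (y ∘ g)) := by
        intro g hg
        refine Finset.mem_filter.2 ⟨Finset.mem_univ _, ?_⟩
        rcases Finset.mem_union.1 hg with hg | hg
        · obtain ⟨z, hzN, hz⟩ := (Finset.mem_filter.1 hg).2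
          exact ⟨z, Finset.mem_insert_of_mem hzN, hz⟩
        · obtain ⟨g', hg', rfl⟩ := Finset.mem_image.1 hg
          exact ⟨x, Finset.mem_insert_self _ _, (Finset.mem_filter.1 hg').2⟩
      have hfin := Finset.card_le_card hsub
      rw [Finset.card_union_of_disjoint hdisj, hB'] at hfin
      refine le_trans ?_ (Nat.cast_le.2 hfin)
      rw [Nat.cast_add]
      have : c * (ε * Fintype.card S) ^ (D + 1) ≤ c * (Fintype.card S' : ℝ) ^ (D + 1) := by
        gcongr
      push_cast
      linarith
  obtain ⟨N, -, hN⟩ := step r le_rfl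
  have h1 : ((Finset.univ.filter fun g : Fin (D + 1) → S =>
        ∃ x ∈ N, x ∈ convexHull ℝ (Set.range (y ∘ g))).card : ℝ) ≤
        (Fintype.card S : ℝ) ^ (D + 1) := by
    have := Finset.card_le_univ (Finset.univ.filter fun g : Fin (D + 1) → S =>
        ∃ x ∈ N, x ∈ convexHull ℝ (Set.range (y ∘ g)))
    rw [Fintype.card_fun, Fintype.card_fin] at this
    exact_mod_cast this
  rw [div_lt_iff₀ (by positivity)] at hr
  rw [mul_pow] at hN
  have : (1 : ℝ) * (Fintype.card S : ℝ) ^ (D + 1) <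
      (r * (c * ε ^ (D + 1))) * (Fintype.card S : ℝ) ^ (D + 1) := by gcongr
  nlinarith

/-- A finite family of convex sets such that every weighting has a point contained in sets of
proportional total weight has a transversal of bounded size. -/
theorem exists_transversal_size (E : Type*) [NormedAddCommGroup E] [InnerProductSpace ℝ E]
    [FiniteDimensional ℝ E] {β : ℝ} (hβ : 0 < β) :
    ∃ r : ℕ, ∀ (ι : Type) [Fintype ι] (K : ι → Set E) [∀ (x : E) i, Decidable (x ∈ K i)],
      (∀ i, Convex ℝ (K i)) →
      (∀ w : ι → ℝ, (∀ i, 0 ≤ w i) → ∑ i, w i = 1 →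
        ∃ x, β ≤ ∑ i, if x ∈ K i then w i else 0) →
      ∃ N : Finset E, N.card ≤ r ∧ ∀ i, ∃ x ∈ N, x ∈ K i := by
  obtain ⟨r, hr⟩ := exists_net_size E (ε := β / 4) (by positivity)
  refine ⟨r, fun ι _ K _ hconv h => ?_⟩
  rcases isEmpty_or_nonempty ι with hι | hι
  · exact ⟨∅, by simp, fun i => hι.elim i⟩
  obtain ⟨L, hL, y, hy⟩ := exists_points_of_fractional K hβ h
  have : Nonempty (Fin L) := ⟨⟨0, hL⟩⟩
  exact hr (Fin L) y ι K hconv (by simpa using hy)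

/-- The vector `x` preceded by a coordinate `1`. -/
def homogenize {d : ℕ} (x : EuclideanSpace ℝ (Fin d)) : Fin (d + 1) → ℝ := Fin.cons 1 fun i => x i

theorem continuous_homogenize {d : ℕ} : Continuous (homogenize (d := d)) := by
  refine continuous_pi fun i => ?_
  refine Fin.cases ?_ (fun i => ?_) i
  · simpa [homogenize] using continuous_const
  · simp only [homogenize, Fin.cons_succ]
    fun_prop

theorem homogenize_combo {d : ℕ} (x y : EuclideanSpace ℝ (Fin d)) (τ : ℝ) :
    homogenize ((1 - τ) • x + τ • y) = (1 - τ) • homogenize x + τ • homogenize y := by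
  funext i
  refine Fin.cases ?_ (fun i => ?_) i
  · simp [homogenize]
  · simp [homogenize]

theorem exists_det_homogenize_ne_zero {d : ℕ} (J : Fin (d + 1) → Set (EuclideanSpace ℝ (Fin d)))
    (hJ : ∀ k, (interior (J k)).Nonempty) :
    ∃ y : Fin (d + 1) → EuclideanSpace ℝ (Fin d), (∀ k, y k ∈ J k) ∧
      (Matrix.of fun k => homogenize (y k)).det ≠ 0 := by
  choose u hu using hJ
  let p : Fin (d + 1) → EuclideanSpace ℝ (Fin d) := Fin.cons 0 fun i => EuclideanSpace.single i 1
  have hp : (Matrix.of fun k => homogenize (p k)).det = 1 := by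
    rw [Matrix.det_of_isLowerTriangular]
    · refine Finset.prod_eq_one fun i _ => ?_
      refine Fin.cases ?_ (fun i => ?_) i
      · simp [homogenize]
      · simp [homogenize, p]
    · intro i j
      refine Fin.cases ?_ (fun j => ?_) j
      · intro h
        exact absurd (OrderDual.toDual_lt_toDual.1 h) (Fin.not_lt_zero _)
      · refine Fin.cases ?_ (fun i => ?_) i
        · simp [homogenize, p]
        · intro h
          have : j ≠ i := by
            rintro rfl
            exact lt_irrefl _ h
          simp [homogenize, p, this]
  let A : Matrix (Fin (d + 1)) (Fin (d + 1)) ℝ :=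
    Matrix.of fun k => homogenize (p k) - homogenize (u k)
  let B : Matrix (Fin (d + 1)) (Fin (d + 1)) ℝ := Matrix.of fun k => homogenize (u k)
  let P : Polynomial ℝ := ((Polynomial.X : Polynomial ℝ) • A.map Polynomial.C + B.map Polynomial.C).det
  have hP : ∀ θ : ℝ, P.eval θ =
      (Matrix.of fun k => homogenize ((1 - θ) • u k + θ • p k)).det := by
    intro θ
    simp only [P]
    rw [← Polynomial.coe_evalRingHom, RingHom.map_det]
    congr 1
    ext k l
    simp only [homogenize_combo]
    simp [A, B]
    ring
  have hP0 : P ≠ 0 := by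
    intro h
    have := hP 1
    simp [h, hp] at this
  have hnear : ∀ᶠ θ : ℝ in nhds 0, ∀ k, (1 - θ) • u k + θ • p k ∈ J k := by
    rw [Filter.eventually_all]
    intro k
    have hc : Continuous fun θ : ℝ => (1 - θ) • u k + θ • p k := by fun_prop
    have := hc.continuousAt (x := 0)
    refine this.eventually_mem ?_
    simpa using mem_interior_iff_mem_nhds.1 (hu k)
  obtain ⟨θ, hθ1, hθ2⟩ : ∃ θ, (∀ k, (1 - θ) • u k + θ • p k ∈ J k) ∧ P.eval θ ≠ 0 := by
    have hinf : Set.Infinite {θ : ℝ | ∀ k, (1 - θ) • u k + θ • p k ∈ J k} :=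
      infinite_of_mem_nhds 0 hnear
    by_contra! hcon
    exact hP0 (Polynomial.eq_zero_of_infinite_isRoot P (hinf.mono fun θ hθ => hcon θ hθ))
  exact ⟨_, hθ1, by rwa [← hP]⟩

/-- Barycentric coordinates with respect to a largest transversal simplex. -/
theorem exists_barycentric_of_max {d : ℕ} (J : Fin (d + 2) → Set (EuclideanSpace ℝ (Fin d)))
    (hJ : ∀ t, IsCompact (J t)) (hJi : ∀ t, (interior (J t)).Nonempty) :
    ∃ e : Fin (d + 1) → Fin (d + 2), Function.Injective e ∧
    ∃ y : Fin (d + 1) → EuclideanSpace ℝ (Fin d), (∀ k, y k ∈ J (e k)) ∧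
    ∃ β : Fin (d + 1) → EuclideanSpace ℝ (Fin d) → ℝ,
      (∀ x, ∑ k, β k x = 1) ∧ (∀ x, ∑ k, β k x • y k = x) ∧ (∀ k, Continuous (β k)) ∧
      (∀ k x y τ, β k ((1 - τ) • x + τ • y) = (1 - τ) * β k x + τ * β k y) ∧
      ∀ t, t ∉ Set.range e → ∀ x ∈ J t, ∀ k, |β k x| ≤ 1 := by
  classical
  let f : (Fin (d + 1) → EuclideanSpace ℝ (Fin d)) → ℝ :=
    fun y => |(Matrix.of fun k => homogenize (y k)).det|
  have hf : Continuous f := by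
    refine continuous_abs.comp (Continuous.matrix_det ?_)
    refine continuous_pi fun k => ?_
    exact continuous_homogenize.comp (continuous_apply k)
  have hmax : ∀ e : Fin (d + 1) ↪ Fin (d + 2), ∃ y, (∀ k, y k ∈ J (e k)) ∧
      ∀ y', (∀ k, y' k ∈ J (e k)) → f y' ≤ f y := by
    intro e
    obtain ⟨y, hy, hm⟩ := (isCompact_univ_pi fun k => hJ (e k)).exists_isMaxOn
      (Set.univ_pi_nonempty_iff.2 fun k => (hJi (e k)).mono interior_subset) hf.continuousOn
    exact ⟨y, fun k => hy k trivial, fun y' hy' => hm fun k _ => hy' k⟩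
  choose Y hY hYmax using hmax
  have : Nonempty (Fin (d + 1) ↪ Fin (d + 2)) := ⟨Fin.castSuccEmb⟩
  obtain ⟨e, he⟩ := Finite.exists_max fun e => f (Y e)
  have hpos : 0 < f (Y e) := by
    obtain ⟨y, hy, hdet⟩ := exists_det_homogenize_ne_zero (fun k => J (e k)) fun k => hJi _
    exact lt_of_lt_of_le (abs_pos.2 hdet) (hYmax e y hy)
  set M : Matrix (Fin (d + 1)) (Fin (d + 1)) ℝ := Matrix.of fun k => homogenize (Y e k) with hM
  have hMdet : M.det ≠ 0 := abs_pos.1 hpos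
  have hcr : ∀ x, ∑ k, ((M.updateRow k (homogenize x)).det / M.det) • M k = homogenize x := by
    intro x
    have h := Matrix.mulVec_cramer M.transpose (homogenize x)
    rw [Matrix.det_transpose] at h
    funext l
    have hl := congrFun h l
    simp only [Matrix.mulVec, dotProduct, Matrix.cramer_transpose_apply, Matrix.transpose_apply,
      Pi.smul_apply, smul_eq_mul] at hl
    simp only [Finset.sum_apply, Pi.smul_apply, smul_eq_mul]
    rw [← mul_right_inj' hMdet, ← hl, Finset.mul_sum]
    refine Finset.sum_congr rfl fun k _ => ?_
    field_simp
  refine ⟨e, e.injective, Y e, hY e, fun k x => (M.updateRow k (homogenize x)).det / M.det,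
    ?_, ?_, ?_, ?_, ?_⟩
  · intro x
    have := congrFun (hcr x) 0
    simpa [hM, homogenize] using this
  · intro x
    ext l
    have := congrFun (hcr x) l.succ
    simpa [hM, homogenize] using this
  · intro k
    refine Continuous.div_const (Continuous.matrix_det ?_) _
    exact continuous_const.matrix_updateRow k continuous_homogenize
  · intro k x y τ
    dsimp only
    rw [homogenize_combo, Matrix.det_updateRow_add, Matrix.det_updateRow_smul,
      Matrix.det_updateRow_smul]
    ring
  · intro t ht x hx k
    dsimp only
    rw [abs_div, div_le_one (abs_pos.2 hMdet)]
    have hinj : Function.Injective (Function.update e k t) := by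
      intro a b hab
      by_cases ha : a = k <;> by_cases hb : b = k
      · rw [ha, hb]
      · subst ha
        simp only [Function.update_self, Function.update_of_ne hb] at hab
        exact absurd ⟨b, hab.symm⟩ ht
      · subst hb
        simp only [Function.update_self, Function.update_of_ne ha] at hab
        exact absurd ⟨a, hab⟩ ht
      · simp only [Function.update_of_ne ha, Function.update_of_ne hb] at hab
        exact e.injective hab
    have h1 := hYmax ⟨_, hinj⟩ (Function.update (Y e) k x) (by
      intro l
      by_cases hl : l = k
      · subst hl
        simpa using hx
      · simpa [hl] using hY e l)
    have h2 := h1.trans (he ⟨_, hinj⟩)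
    have h3 : M.updateRow k (homogenize x) =
        Matrix.of fun l => homogenize (Function.update (Y e) k x l) := by
      ext l m
      by_cases hl : l = k
      · subst hl
        simp
      · simp [hl, hM]
    rw [h3]
    exact h2

theorem exists_simultaneously_large {V : Type*} [NormedAddCommGroup V] [NormedSpace ℝ V]
    {J : Set V} (hJ : IsCompact J) (hconv : Convex ℝ J) (hne : J.Nonempty) (n : ℕ)
    (β : Fin n → V → ℝ) (hβ : ∀ k, Continuous (β k))
    (haff : ∀ k x y τ, β k ((1 - τ) • x + τ • y) = (1 - τ) * β k x + τ * β k y) :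
    ∃ y ∈ J, ∀ k, ∀ x ∈ J, (1 / 8 : ℝ) ^ n * |β k x| ≤ |β k y| := by
  induction n with
  | zero =>
    obtain ⟨y, hy⟩ := hne
    exact ⟨y, hy, fun k => k.elim0⟩
  | succ n ih =>
    obtain ⟨y, hy, hlarge⟩ := ih (fun k => β k.castSucc) (fun k => hβ _) (fun k => haff _)
    obtain ⟨u, hu, hmax⟩ := hJ.exists_isMaxOn hne (continuous_abs.comp (hβ (Fin.last n))).continuousOn
    have hmax' : ∀ x ∈ J, |β (Fin.last n) x| ≤ |β (Fin.last n) u| := fun x hx => hmax hx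
    set c : ℝ := (1 / 8 : ℝ) ^ n with hc
    have hc0 : 0 < c := by positivity
    have hc1 : c ≤ 1 := pow_le_one₀ (by norm_num) (by norm_num)
    by_cases hcase : c / 8 * |β (Fin.last n) u| ≤ |β (Fin.last n) y|
    · refine ⟨y, hy, fun k x hx => ?_⟩
      rw [pow_succ, ← hc]
      refine Fin.lastCases ?_ (fun k => ?_) k
      · have := hmax' x hx
        have : c / 8 * |β (Fin.last n) x| ≤ c / 8 * |β (Fin.last n) u| := by gcongr
        linarith
      · have := hlarge k x hx
        have := abs_nonneg (β k.castSucc x)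
        nlinarith
    · refine ⟨(1 - c / 4) • y + (c / 4) • u, hconv hy hu (by linarith) (by positivity) (by ring),
        fun k x hx => ?_⟩
      rw [pow_succ, ← hc]
      refine Fin.lastCases ?_ (fun k => ?_) k
      · rw [haff]
        have h1 := hmax' x hx
        push Not at hcase
        have h2 : |c / 4 * β (Fin.last n) u| - |(1 - c / 4) * β (Fin.last n) y| ≤
            |(1 - c / 4) * β (Fin.last n) y + c / 4 * β (Fin.last n) u| := by
          have := abs_sub_abs_le_abs_sub (c / 4 * β (Fin.last n) u) (-((1 - c / 4) * β (Fin.last n) y))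
          rw [abs_neg, sub_neg_eq_add, add_comm (c / 4 * _)] at this
          exact this
        rw [abs_mul, abs_mul, abs_of_pos (by positivity : 0 < c / 4),
          abs_of_nonneg (by linarith : 0 ≤ 1 - c / 4)] at h2
        have h3 : (1 - c / 4) * |β (Fin.last n) y| ≤ 1 * |β (Fin.last n) y| := by
          gcongr
          linarith
        have h4 : c / 8 * |β (Fin.last n) x| ≤ c / 8 * |β (Fin.last n) u| := by gcongr
        linarith
      · rw [haff]
        have h1 := hlarge k x hx
        have h1u := hlarge k u hu
        have h2 : |(1 - c / 4) * β k.castSucc y| - |c / 4 * β k.castSucc u| ≤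
            |(1 - c / 4) * β k.castSucc y + c / 4 * β k.castSucc u| := by
          have := abs_sub_abs_le_abs_sub ((1 - c / 4) * β k.castSucc y) (-(c / 4 * β k.castSucc u))
          rwa [abs_neg, sub_neg_eq_add] at this
        rw [abs_mul, abs_mul, abs_of_pos (by positivity : 0 < c / 4),
          abs_of_nonneg (by linarith : 0 ≤ 1 - c / 4)] at h2
        have := abs_nonneg (β k.castSucc x)
        have := abs_nonneg (β k.castSucc y)
        have h5 : c / 4 * |β k.castSucc u| ≤ 1 / 4 * |β k.castSucc y| := by linarith
        have h6 : c / 4 * |β k.castSucc y| ≤ 1 / 4 * |β k.castSucc y| := by gcongr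
        nlinarith

theorem Convex.sum_smul_mem_of_ne_zero {V ι : Type*} [AddCommGroup V] [Module ℝ V] [Fintype ι]
    {K : Set V} (hK : Convex ℝ K) {w : ι → ℝ} {y : ι → V} (hw : ∀ i, 0 ≤ w i)
    (hs : ∑ i, w i = 1) (hy : ∀ i, w i ≠ 0 → y i ∈ K) : ∑ i, w i • y i ∈ K := by
  rw [← finsum_eq_sum_of_fintype] at hs ⊢
  exact hK.finsum_mem hw hs hy

/-- If all the intersections of `d + 1` among `d + 2` compact convex sets have interior points, then
one of these intersections has a shrunk copy inside the remaining set, located near to it. -/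
theorem exists_homothet_subset {d : ℕ} (K : Fin (d + 2) → Set (EuclideanSpace ℝ (Fin d)))
    (hK : ∀ s, Convex ℝ (K s)) (hKc : ∀ s, IsCompact (K s))
    (hi : ∀ t : Fin (d + 2), (interior (⋂ s : Fin (d + 1), K (t.succAbove s))).Nonempty) :
    ∃ t : Fin (d + 2), ∃ z ∈ ⋂ s : Fin (d + 1), K (t.succAbove s),
      ∃ y ∈ ⋂ s : Fin (d + 1), K (t.succAbove s), ∀ x ∈ ⋂ s : Fin (d + 1), K (t.succAbove s),
        (1 + 1 / (2 * (d + 1)) : ℝ) • z - (1 / (2 * (d + 1)) : ℝ) • y +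
          (1 / (4 * (d + 1)) * (1 / 8) ^ (d + 1) : ℝ) • (x - z) ∈ K t := by
  classical
  set J : Fin (d + 2) → Set (EuclideanSpace ℝ (Fin d)) :=
    fun t => ⋂ s : Fin (d + 1), K (t.succAbove s) with hJ
  have hJc : ∀ t, IsCompact (J t) := fun t => IsCompact.iInter_of_nonempty fun s => hKc _
  have hJconv : ∀ t, Convex ℝ (J t) := fun t => convex_iInter fun s => hK _
  have hJK : ∀ t s, s ≠ t → J t ⊆ K s := by
    intro t s hst
    obtain ⟨s', rfl⟩ := Fin.exists_succAbove_eq hst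
    exact Set.iInter_subset _ s'
  obtain ⟨e, he, y, hy, β, hβ1, hβy, hβc, hβa, hβle⟩ := exists_barycentric_of_max J hJc hi
  obtain ⟨t, ht⟩ : ∃ t, t ∉ Set.range e := by
    by_contra! hcon
    have := Fintype.card_le_of_surjective e hcon
    simp at this
  have hte : ∀ s, s ≠ t → ∃ k, e k = s := by
    intro s hs
    by_contra! hcon
    have hinj : Function.Injective fun o : Option (Option (Fin (d + 1))) =>
        o.elim t fun o => o.elim s e := by
      rintro (_ | _ | a) (_ | _ | b) h
      · rfl
      · exact absurd h.symm hs
      · exact absurd ⟨b, h.symm⟩ ht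
      · exact absurd h hs
      · rfl
      · exact absurd h.symm (hcon b)
      · exact absurd ⟨a, h⟩ ht
      · exact absurd h (hcon a)
      · exact congrArg _ (congrArg _ (he h))
    have := Fintype.card_le_of_injective _ hinj
    simp at this
  obtain ⟨u, hu, hlarge⟩ := exists_simultaneously_large (hJc t) (hJconv t)
    ((hi t).mono interior_subset) (d + 1) β hβc hβa
  set c₀ : ℝ := (1 / 8) ^ (d + 1) with hc₀
  have hc₀0 : 0 < c₀ := by positivity
  have hc₀1 : c₀ ≤ 1 := pow_le_one₀ (by norm_num) (by norm_num)
  set c : ℝ := 1 / (2 * (d + 1)) with hc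
  have hcpos : 0 < c := by positivity
  have hη : (1 / (4 * (d + 1)) * c₀ : ℝ) = c * c₀ / 2 := by
    rw [hc]
    field_simp
    ring
  set B : ℝ := ∑ k, max (β k u) 0 with hB
  have hB1 : 1 ≤ B := by
    rw [← hβ1 u]
    exact Finset.sum_le_sum fun k _ => le_max_left _ _
  have hBd : B ≤ d + 1 := by
    have : B ≤ ∑ k : Fin (d + 1), (1 : ℝ) := by
      refine Finset.sum_le_sum fun k _ => max_le ?_ zero_le_one
      exact (le_abs_self _).trans (hβle t ht u hu k)
    simpa using this
  have hBpos : 0 < B := by linarith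
  set ζ : Fin (d + 1) → ℝ := fun k => max (β k u) 0 / B with hζ
  have hζ0 : ∀ k, 0 ≤ ζ k := fun k => div_nonneg (le_max_right _ _) hBpos.le
  have hζ1 : ∑ k, ζ k = 1 := by
    rw [← Finset.sum_div, div_self hBpos.ne']
  have hsu : ∀ (a : ℝ) x, a • x = ∑ k, (a * β k x) • y k := by
    intro a x
    simp only [mul_smul, ← Finset.smul_sum, hβy x]
  have hyK : ∀ k s, e k ≠ s → y k ∈ K s := fun k s hks => hJK (e k) s hks.symm (hy k)
  have hzJ : ∑ k, ζ k • y k ∈ J t := by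
    refine Set.mem_iInter.2 fun s => ?_
    obtain ⟨k, hk⟩ := hte _ (Fin.succAbove_ne t s)
    rw [← hk]
    rcases le_or_gt (β k u) 0 with hneg | hpos
    · refine (hK _).sum_smul_mem_of_ne_zero hζ0 hζ1 fun l hl => hyK l _ fun h => hl ?_
      rw [he h]
      simp [hζ, hneg]
    · let w : Option (Fin (d + 1)) → ℝ := fun o => o.elim (1 / B) fun l => max (-β l u) 0 / B
      let p : Option (Fin (d + 1)) → EuclideanSpace ℝ (Fin d) := fun o => o.elim u y
      have hmm : ∀ l, max (β l u) 0 = β l u + max (-β l u) 0 := by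
        intro l
        rcases le_total (β l u) 0 with h | h
        · rw [max_eq_right h, max_eq_left (by linarith)]; ring
        · rw [max_eq_left h, max_eq_right (by linarith)]; ring
      have hz : ∑ k, ζ k • y k = ∑ o, w o • p o := by
        rw [Fintype.sum_option]
        simp only [w, p, Option.elim]
        rw [hsu, ← Finset.sum_add_distrib]
        refine Finset.sum_congr rfl fun l _ => ?_
        rw [← add_smul, hζ]
        dsimp only
        rw [hmm l]
        congr 1
        ring
      rw [hz]
      refine (hK _).sum_smul_mem_of_ne_zero ?_ ?_ ?_
      · rintro (_ | l)
        · exact div_nonneg zero_le_one hBpos.le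
        · exact div_nonneg (le_max_right _ _) hBpos.le
      · rw [Fintype.sum_option]
        simp only [w, Option.elim]
        rw [← Finset.sum_div, ← add_div, div_eq_one_iff_eq hBpos.ne', hB]
        simp only [hmm]
        rw [Finset.sum_add_distrib, hβ1]
      · rintro (_ | l) hl
        · exact hJK t _ (fun h => ht ⟨k, h⟩) hu
        · refine hyK l _ fun h => hl ?_
          rw [he h]
          simp [w, hpos.le]
  refine ⟨t, _, hzJ, u, hu, fun x hx => ?_⟩
  have hcomb : (1 + c) • (∑ k, ζ k • y k) - c • u + (1 / (4 * (d + 1)) * c₀ : ℝ) •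
      (x - ∑ k, ζ k • y k) = ∑ k, ((1 + c) * ζ k - c * β k u + c * c₀ / 2 * (β k x - ζ k)) • y k := by
    rw [hη, smul_sub, hsu c u, hsu (c * c₀ / 2) x]
    simp only [Finset.smul_sum, ← Finset.sum_sub_distrib, ← Finset.sum_add_distrib]
    refine Finset.sum_congr rfl fun l _ => ?_
    module
  rw [hcomb]
  refine (hK t).sum_smul_mem_of_ne_zero (fun k => ?_) ?_ fun k _ => hyK k t fun h => ht ⟨k, h⟩
  · have h1 := hlarge k x hx
    have h2 : ζ k ≤ |β k u| := by
      rw [hζ]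
      dsimp only
      rw [div_le_iff₀ hBpos]
      have : max (β k u) 0 ≤ |β k u| := max_le (le_abs_self _) (abs_nonneg _)
      nlinarith [abs_nonneg (β k u)]
    have h3 : c * |β k u| ≤ (1 + c) * ζ k - c * β k u := by
      rcases le_or_gt (β k u) 0 with hneg | hpos
      · rw [abs_of_nonpos hneg]
        have := hζ0 k
        nlinarith
      · rw [abs_of_pos hpos]
        have h4 : 2 * c * β k u ≤ ζ k := by
          rw [hζ]
          dsimp only
          rw [max_eq_left hpos.le, le_div_iff₀ hBpos]
          have : 2 * c * B ≤ 1 := by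
            rw [hc]
            have : (2 * (1 / (2 * (d + 1))) * B : ℝ) = B / (d + 1) := by field_simp
            rw [this, div_le_one (by positivity)]
            exact hBd
          nlinarith
        have := hζ0 k
        nlinarith
    have h5 : c₀ * (ζ k - β k x) ≤ 2 * |β k u| := by
      have := neg_abs_le (β k x)
      have h6 : c₀ * ζ k ≤ 1 * |β k u| := mul_le_mul hc₀1 h2 (hζ0 k) zero_le_one
      nlinarith
    nlinarith
  · simp only [Finset.sum_add_distrib, Finset.sum_sub_distrib, ← Finset.mul_sum, hζ1, hβ1]
    ring

theorem exists_frame_of_volume (d : ℕ) : ∃ δ > (0 : ℝ),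
    ∀ J : Set (EuclideanSpace ℝ (Fin d)), IsCompact J → (interior J).Nonempty →
      1 / 2 ≤ volume J → ∃ o ∈ J,
      ∃ T : EuclideanSpace ℝ (Fin d) →ₗ[ℝ] EuclideanSpace ℝ (Fin d), δ ≤ |LinearMap.det T| ∧
        (∀ k, o + T (EuclideanSpace.single k 1) ∈ J) ∧
        ∀ x ∈ J, ∃ a : EuclideanSpace ℝ (Fin d), (∀ k, |a k| ≤ 1) ∧ x = o + T a := by
  let Q : Set (EuclideanSpace ℝ (Fin d)) := {x | ∀ k, |x k| ≤ 1}
  have hQ : volume Q < ⊤ := by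
    refine Bornology.IsBounded.measure_lt_top ?_
    refine isBounded_iff_forall_norm_le.2 ⟨√(∑ _k : Fin d, 1), fun x hx => ?_⟩
    rw [EuclideanSpace.norm_eq]
    refine Real.sqrt_le_sqrt (Finset.sum_le_sum fun k _ => ?_)
    have h1 : |x k| ≤ 1 := hx k
    rw [Real.norm_eq_abs]
    exact pow_le_one₀ (abs_nonneg _) h1
  refine ⟨1 / (2 * ((volume Q).toReal + 1)), by positivity, fun J hJc hJi hvol => ?_⟩
  obtain ⟨e, he, y, hy, β, hβ1, hβy, hβc, hβa, hβle⟩ :=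
    exists_barycentric_of_max (fun _ : Fin (d + 2) => J) (fun _ => hJc) (fun _ => hJi)
  obtain ⟨t, ht⟩ : ∃ t, t ∉ Set.range e := by
    by_contra! hcon
    have := Fintype.card_le_of_surjective e hcon
    simp at this
  let T : EuclideanSpace ℝ (Fin d) →ₗ[ℝ] EuclideanSpace ℝ (Fin d) :=
    (EuclideanSpace.basisFun (Fin d) ℝ).toBasis.constr ℝ fun k => y k.succ - y 0
  have hT : ∀ k, T (EuclideanSpace.single k 1) = y k.succ - y 0 := by
    intro k
    have := (EuclideanSpace.basisFun (Fin d) ℝ).toBasis.constr_basis ℝ (fun k => y k.succ - y 0) k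
    rwa [OrthonormalBasis.coe_toBasis, EuclideanSpace.basisFun_apply] at this
  have hTa : ∀ a : EuclideanSpace ℝ (Fin d), T a = ∑ k, a k • (y k.succ - y 0) := by
    intro a
    simp [T, Module.Basis.constr_apply_fintype]
  have hcov : ∀ x ∈ J, ∃ a : EuclideanSpace ℝ (Fin d), (∀ k, |a k| ≤ 1) ∧ x = y 0 + T a := by
    intro x hx
    refine ⟨WithLp.toLp 2 fun k => β k.succ x, fun k => hβle t ht x hx _, ?_⟩
    rw [hTa]
    have h1 := hβy x
    have h2 := hβ1 x
    rw [Fin.sum_univ_succ] at h1 h2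
    simp only [smul_sub, Finset.sum_sub_distrib, ← Finset.sum_smul]
    rw [← eq_sub_iff_add_eq] at h2
    rw [h2] at h1
    nth_rewrite 1 [← h1]
    module
  refine ⟨y 0, hy 0, T, ?_, fun k => ?_, hcov⟩
  · have hsub : J ⊆ (fun x => y 0 + x) '' (T '' Q) := by
      intro x hx
      obtain ⟨a, ha, rfl⟩ := hcov x hx
      exact ⟨T a, ⟨a, ha, rfl⟩, rfl⟩
    have h1 : (1 / 2 : ENNReal) ≤ ENNReal.ofReal |LinearMap.det T| * volume Q := by
      refine hvol.trans ((measure_mono hsub).trans ?_)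
      rw [Set.image_add_left, measure_preimage_add, Measure.addHaar_image_linearMap]
    have h2 : (1 / 2 : ℝ) ≤ |LinearMap.det T| * (volume Q).toReal := by
      have := ENNReal.toReal_mono (ENNReal.mul_ne_top ENNReal.ofReal_ne_top hQ.ne) h1
      rwa [ENNReal.toReal_mul, ENNReal.toReal_ofReal (abs_nonneg _), ENNReal.toReal_div,
        ENNReal.toReal_one, ENNReal.toReal_ofNat] at this
    have h0 : 0 ≤ (volume Q).toReal := ENNReal.toReal_nonneg
    rw [div_le_iff₀ (by positivity)]
    nlinarith [abs_nonneg (LinearMap.det T)]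
  · rw [hT]
    simpa using hy k.succ

/-- A body of volume at least `1 / 2` determines boundedly many simplices of large volume, one of
which is in every convex set containing a suitable homothetic copy of the body. -/
theorem exists_simplex_list (d : ℕ) (hd : 0 < d) {η : ℝ} (hη : 0 < η) (hη1 : η ≤ 1) :
    ∃ G : ℕ, ∃ δ > (0 : ℝ), ∀ J : Set (EuclideanSpace ℝ (Fin d)), IsCompact J →
      (interior J).Nonempty → 1 / 2 ≤ volume J →
      ∃ T : EuclideanSpace ℝ (Fin d) →ₗ[ℝ] EuclideanSpace ℝ (Fin d), δ ≤ |LinearMap.det T| ∧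
      ∃ q : (Fin d → Finset.Icc (-G : ℤ) G) → EuclideanSpace ℝ (Fin d),
        ∀ c : ℝ, 0 ≤ c → c ≤ 1 → ∀ z ∈ J, ∀ y ∈ J, ∃ g, ∀ K : Set (EuclideanSpace ℝ (Fin d)),
          Convex ℝ K → (∀ x ∈ J, (1 + c) • z - c • y + η • (x - z) ∈ K) →
          q g ∈ K ∧ ∀ k, q g + T (EuclideanSpace.single k 1) ∈ K := by
  obtain ⟨δ, hδ, hframe⟩ := exists_frame_of_volume d
  have hd' : (0 : ℝ) < d := by exact_mod_cast hd
  set h : ℝ := η / (2 * d) with hh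
  have hh0 : 0 < h := by positivity
  obtain ⟨G, hG⟩ := exists_nat_ge (4 / h + 1)
  refine ⟨G, (η / 2) ^ d * δ, by positivity, fun J hJc hJi hvol => ?_⟩
  obtain ⟨o, ho, T, hT, hTJ, hcov⟩ := hframe J hJc hJi hvol
  refine ⟨(η / 2) • T, ?_, fun g => o + T (WithLp.toLp 2 fun k => h * ((g k : ℤ) : ℝ)), ?_⟩
  · rw [LinearMap.det_smul, finrank_euclideanSpace_fin, abs_mul,
      abs_of_pos (by positivity : 0 < (η / 2) ^ d)]
    gcongr
  intro c hc0 hc1 z hz y hy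
  obtain ⟨az, haz, hzo⟩ := hcov z hz
  obtain ⟨ay, hay, hyo⟩ := hcov y hy
  let a : EuclideanSpace ℝ (Fin d) := (1 + c - η) • az - c • ay
  have ha : ∀ k, |a k| ≤ 4 := by
    intro k
    have h1 := abs_le.1 (haz k)
    have h2 := abs_le.1 (hay k)
    have : a k = (1 + c - η) * az k - c * ay k := by simp [a]
    rw [this, abs_le]
    have : 0 ≤ 1 + c - η := by linarith
    constructor <;> nlinarith
  have hq0 : (1 + c) • z - c • y + η • (o - z) = o + T a := by
    rw [hzo, hyo]
    simp only [a, map_sub, map_smul]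
    module
  have hceil : ∀ k, ⌈a k / h⌉ ∈ Finset.Icc (-G : ℤ) G := by
    intro k
    have h1 := abs_le.1 (ha k)
    have h2 : a k / h ≤ 4 / h := by gcongr; exact h1.2
    have h3 : -(4 / h) ≤ a k / h := by rw [← neg_div]; gcongr; exact h1.1
    have h4 := Int.le_ceil (a k / h)
    have h5 := Int.ceil_lt_add_one (a k / h)
    rw [Finset.mem_Icc]
    constructor
    · have : (-G : ℝ) ≤ (⌈a k / h⌉ : ℝ) := by linarith
      exact_mod_cast this
    · have : (⌈a k / h⌉ : ℝ) ≤ G := by linarith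
      exact_mod_cast this
  refine ⟨fun k => ⟨⌈a k / h⌉, hceil k⟩, fun K hK hJK => ?_⟩
  have hv : ∀ k, o + T a + η • T (EuclideanSpace.single k 1) ∈ K := by
    intro k
    have := hJK _ (hTJ k)
    rw [← hq0]
    convert this using 1
    module
  have hv0 : o + T a ∈ K := by
    rw [← hq0]
    exact hJK o ho
  have hmem : ∀ b : EuclideanSpace ℝ (Fin d), (∀ k, 0 ≤ b k) → ∑ k, b k ≤ η →
      o + T a + T b ∈ K := by
    intro b hb0 hbs
    have hTb : T b = ∑ k, b k • T (EuclideanSpace.single k 1) := by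
      conv_lhs => rw [← (EuclideanSpace.basisFun (Fin d) ℝ).sum_repr b]
      simp
    let w : Option (Fin d) → ℝ := fun o => o.elim (1 - (∑ k, b k) / η) fun k => b k / η
    let p : Option (Fin d) → EuclideanSpace ℝ (Fin d) := fun i =>
      i.elim (o + T a) fun k => o + T a + η • T (EuclideanSpace.single k 1)
    have : o + T a + T b = ∑ i, w i • p i := by
      rw [Fintype.sum_option, hTb]
      simp only [w, p, Option.elim, smul_add (b _ / η), Finset.sum_add_distrib, smul_smul,
        ← Finset.sum_smul, ← Finset.sum_div]
      simp only [div_mul_cancel₀ _ hη.ne']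
      module
    rw [this]
    refine hK.sum_smul_mem_of_ne_zero ?_ ?_ ?_
    · rintro (_ | k)
      · exact sub_nonneg.2 ((div_le_one hη).2 hbs)
      · exact div_nonneg (hb0 k) hη.le
    · rw [Fintype.sum_option]
      simp only [w, Option.elim, ← Finset.sum_div]
      ring
    · rintro (_ | k) -
      · exact hv0
      · exact hv k
  let b : EuclideanSpace ℝ (Fin d) := WithLp.toLp 2 fun k => h * (⌈a k / h⌉ : ℝ) - a k
  have hb : ∀ k, 0 ≤ b k ∧ b k ≤ h := by
    intro k
    have h4 := Int.le_ceil (a k / h)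
    have h5 := Int.ceil_lt_add_one (a k / h)
    have hk : b k = h * ((⌈a k / h⌉ : ℝ) - a k / h) := by
      simp only [b]
      field_simp
    rw [hk]
    constructor
    · exact mul_nonneg hh0.le (by linarith)
    · nlinarith
  have hbs : ∑ k, b k ≤ η / 2 := by
    calc ∑ k, b k ≤ ∑ _k : Fin d, h := Finset.sum_le_sum fun k _ => (hb k).2
      _ = η / 2 := by
        rw [Finset.sum_const, Finset.card_univ, Fintype.card_fin, nsmul_eq_mul, hh]
        field_simp
  have hq : o + T (WithLp.toLp 2 fun k => h * (⌈a k / h⌉ : ℝ)) = o + T a + T b := by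
    rw [add_assoc, ← map_add]
    congr 2
    ext k
    simp [b]
  refine ⟨?_, fun k => ?_⟩
  · dsimp only
    rw [hq]
    exact hmem b (fun k => (hb k).1) (by linarith)
  · dsimp only
    rw [hq, LinearMap.smul_apply, ← map_smul, add_assoc, ← map_add]
    refine hmem _ (fun l => ?_) ?_
    · have := (hb l).1
      by_cases hl : l = k
      · subst hl
        simp
        positivity
      · simpa [hl] using this
    · simp only [PiLp.add_apply, PiLp.smul_apply, Finset.sum_add_distrib, smul_eq_mul,
        ← Finset.mul_sum]
      simp
      linarith

theorem exists_orthonormal_lowerTriangular {d : ℕ}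
    (T : EuclideanSpace ℝ (Fin d) →ₗ[ℝ] EuclideanSpace ℝ (Fin d)) :
    ∃ b : OrthonormalBasis (Fin d) ℝ (EuclideanSpace ℝ (Fin d)),
      (∀ j k, j < k → T (b k) j = 0) ∧ |∏ k, T (b k) k| = |LinearMap.det T| := by
  let r : Fin d → EuclideanSpace ℝ (Fin d) :=
    fun j => WithLp.toLp 2 fun k => T (EuclideanSpace.single k 1) j
  let b := InnerProductSpace.gramSchmidtOrthonormalBasis (𝕜 := ℝ)
    (finrank_euclideanSpace : Module.finrank ℝ (EuclideanSpace ℝ (Fin d)) = _) r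
  have hr : ∀ x j, inner ℝ x (r j) = T x j := by
    intro x j
    have hTx : T x = ∑ k, x k • T (EuclideanSpace.single k 1) := by
      conv_lhs => rw [← (EuclideanSpace.basisFun (Fin d) ℝ).sum_repr x]
      simp
    rw [hTx]
    simp [r, PiLp.inner_apply, mul_comm]
  have htri : ∀ j k, j < k → T (b k) j = 0 := by
    intro j k hjk
    rw [← hr]
    exact InnerProductSpace.gramSchmidtOrthonormalBasis_inv_triangular _ r hjk
  refine ⟨b, htri, ?_⟩
  let s := EuclideanSpace.basisFun (Fin d) ℝ
  have h1 : s.toBasis.det (T ∘ b) = LinearMap.det T * s.toBasis.det b := Module.Basis.det_comp _ _ _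
  have h2 : s.toBasis.det (T ∘ b) = ∏ k, T (b k) k := by
    rw [Module.Basis.det_apply, Matrix.det_of_isLowerTriangular]
    · simp [Module.Basis.toMatrix_apply, s]
    · intro i j hij
      simpa [Module.Basis.toMatrix_apply, s] using htri i j hij
  rw [← h2, h1, abs_mul]
  rcases s.det_to_matrix_orthonormalBasis_real b with h | h <;> rw [h] <;> simp

/-- The space of simplices of `ℝ^d` given by a vertex and the `d` edges at this vertex. -/
abbrev SimplexSpace (d : ℕ) : Type := PiLp 2 fun _ : Option (Fin d) => EuclideanSpace ℝ (Fin d)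

/-- The simplices inside `C` whose edge matrix is lower triangular, with positive diagonal entries
of product at least `ρ`. -/
def triangularSimplices {d : ℕ} (ρ : ℝ) (C : Set (EuclideanSpace ℝ (Fin d))) :
    Set (SimplexSpace d) :=
  {y | (∀ j k, j < k → y (some k) j = 0) ∧ (∀ k, 0 < y (some k) k) ∧ ρ ≤ ∏ k, y (some k) k ∧
    y none ∈ C ∧ ∀ k, y none + y (some k) ∈ C}

theorem convex_triangularSimplices {d : ℕ} {ρ : ℝ} (hρ : 0 < ρ)
    {C : Set (EuclideanSpace ℝ (Fin d))} (hC : Convex ℝ C) :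
    Convex ℝ (triangularSimplices ρ C) := by
  rintro x ⟨hx1, hx2, hx3, hx4, hx5⟩ y ⟨hy1, hy2, hy3, hy4, hy5⟩ a b ha hb hab
  have hpos : ∀ k, 0 < a * x (some k) k + b * y (some k) k := by
    intro k
    have h1 := hx2 k
    have h2 := hy2 k
    rcases ha.eq_or_lt with rfl | ha
    · have : b = 1 := by linarith
      subst this
      simpa using h2
    · have := mul_pos ha h1
      have := mul_nonneg hb h2.le
      linarith
  refine ⟨fun j k hjk => ?_, fun k => ?_, ?_, hC hx4 hy4 ha hb hab, fun k => ?_⟩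
  · simp [hx1 j k hjk, hy1 j k hjk]
  · simpa using hpos k
  · have hsum : ∀ z : SimplexSpace d, (∀ k, 0 < z (some k) k) →
        Real.log (∏ k, z (some k) k) = ∑ k, Real.log (z (some k) k) :=
      fun z hz => Real.log_prod fun k _ => (hz k).ne'
    have hlx : Real.log ρ ≤ ∑ k, Real.log (x (some k) k) := by
      rw [← hsum x hx2]
      exact Real.log_le_log hρ hx3
    have hly : Real.log ρ ≤ ∑ k, Real.log (y (some k) k) := by
      rw [← hsum y hy2]
      exact Real.log_le_log hρ hy3
    have hz2 : ∀ k, 0 < (a • x + b • y) (some k) k := fun k => by simpa using hpos k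
    rw [← Real.log_le_log_iff hρ (Finset.prod_pos fun k _ => hz2 k), hsum _ hz2]
    calc Real.log ρ = a * Real.log ρ + b * Real.log ρ := by rw [← add_mul, hab, one_mul]
      _ ≤ a * ∑ k, Real.log (x (some k) k) + b * ∑ k, Real.log (y (some k) k) := by gcongr
      _ = ∑ k, (a * Real.log (x (some k) k) + b * Real.log (y (some k) k)) := by
        rw [Finset.mul_sum, Finset.mul_sum, Finset.sum_add_distrib]
      _ ≤ _ := by
        refine Finset.sum_le_sum fun k _ => ?_
        have := strictConcaveOn_log_Ioi.concaveOn.2 (Set.mem_Ioi.2 (hx2 k)) (Set.mem_Ioi.2 (hy2 k))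
          ha hb hab
        simpa using this
  · have := hC (hx5 k) (hy5 k) ha hb hab
    convert this using 1
    simp only [PiLp.add_apply, PiLp.smul_apply]
    module

theorem exists_triangularSimplex {d : ℕ} {δ : ℝ} (hδ : 0 < δ)
    (T : EuclideanSpace ℝ (Fin d) →ₗ[ℝ] EuclideanSpace ℝ (Fin d)) (hT : δ ≤ |LinearMap.det T|)
    (q : EuclideanSpace ℝ (Fin d)) :
    ∃ y : SimplexSpace d, ∀ K : Set (EuclideanSpace ℝ (Fin d)), Convex ℝ K → q ∈ K →
      (∀ k, q + T (EuclideanSpace.single k 1) ∈ K) →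
        y ∈ triangularSimplices ((1 / (d + 1) ^ 2 : ℝ) ^ d * δ) K := by
  obtain ⟨b, htri, hdet⟩ := exists_orthonormal_lowerTriangular T
  set s : ℝ := 1 / (d + 1) ^ 2 with hs
  have hs0 : 0 < s := by positivity
  have hne : ∀ k, T (b k) k ≠ 0 := by
    intro k hk
    have h0 : ∏ k, T (b k) k = 0 := Finset.prod_eq_zero (Finset.mem_univ k) hk
    rw [h0, abs_zero] at hdet
    linarith
  let σ : Fin d → ℝ := fun k => if 0 < T (b k) k then 1 else -1
  have hσ : ∀ k, σ k * T (b k) k = |T (b k) k| := by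
    intro k
    simp only [σ]
    split_ifs with h
    · rw [abs_of_pos h, one_mul]
    · rw [abs_of_nonpos (not_lt.1 h)]
      ring
  have hσ1 : ∀ k, |σ k| = 1 := by
    intro k
    simp only [σ]
    split_ifs <;> simp
  let u : EuclideanSpace ℝ (Fin d) := WithLp.toLp 2 fun _ => 1 / (d + 1 : ℝ)
  let y : SimplexSpace d := WithLp.toLp 2 fun o => o.elim (q + T u) fun k => (s * σ k) • T (b k)
  have hyn : y none = q + T u := rfl
  have hys : ∀ k, y (some k) = (s * σ k) • T (b k) := fun k => rfl
  refine ⟨y, fun K hK hq hqT => ?_⟩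
  have hmem : ∀ a : EuclideanSpace ℝ (Fin d), (∀ k, 0 ≤ a k) → ∑ k, a k ≤ 1 → q + T a ∈ K := by
    intro a ha0 has
    have hTa : T a = ∑ k, a k • T (EuclideanSpace.single k 1) := by
      conv_lhs => rw [← (EuclideanSpace.basisFun (Fin d) ℝ).sum_repr a]
      simp
    let w : Option (Fin d) → ℝ := fun o => o.elim (1 - ∑ k, a k) fun k => a k
    let p : Option (Fin d) → EuclideanSpace ℝ (Fin d) := fun i =>
      i.elim q fun k => q + T (EuclideanSpace.single k 1)
    have : q + T a = ∑ i, w i • p i := by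
      rw [Fintype.sum_option, hTa]
      simp only [w, p, Option.elim, smul_add, Finset.sum_add_distrib, ← Finset.sum_smul]
      module
    rw [this]
    refine hK.sum_smul_mem_of_ne_zero ?_ ?_ ?_
    · rintro (_ | k)
      · exact sub_nonneg.2 has
      · exact ha0 k
    · rw [Fintype.sum_option]
      simp only [w, Option.elim]
      ring
    · rintro (_ | k) -
      · exact hq
      · exact hqT k
  refine ⟨fun j k hjk => ?_, fun k => ?_, ?_, ?_, fun k => ?_⟩
  · rw [hys]
    simp [htri j k hjk]
  · rw [hys, PiLp.smul_apply, smul_eq_mul, mul_assoc, hσ]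
    exact mul_pos hs0 (abs_pos.2 (hne k))
  · simp only [hys, PiLp.smul_apply, smul_eq_mul, mul_assoc, hσ]
    rw [Finset.prod_mul_distrib, ← Finset.abs_prod, hdet, Finset.prod_const, Finset.card_univ,
      Fintype.card_fin]
    gcongr
  · rw [hyn]
    refine hmem u (fun k => by simp only [u]; positivity) ?_
    simp only [u, Finset.sum_const, Finset.card_univ, Fintype.card_fin, nsmul_eq_mul]
    rw [mul_one_div, div_le_one (by positivity)]
    linarith
  · have hbk : ∀ l, |b k l| ≤ 1 := by
      intro l
      have := PiLp.norm_apply_le (b k) l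
      rwa [b.orthonormal.1 k] at this
    have hterm : ∀ l, |s * σ k * b k l| ≤ s := by
      intro l
      rw [abs_mul, abs_mul, hσ1, abs_of_pos hs0, mul_one]
      exact mul_le_of_le_one_right hs0.le (hbk l)
    rw [hyn, hys, add_assoc, ← map_smul, ← map_add]
    have hsd : s * (d + 1) = 1 / (d + 1) := by
      rw [hs]
      field_simp
    refine hmem _ (fun l => ?_) ?_
    · have h1 := (abs_le.1 (hterm l)).1
      have h2 : s ≤ 1 / (d + 1) := by
        rw [← hsd]
        have : (0 : ℝ) ≤ d := by positivity
        nlinarith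
      simp only [PiLp.add_apply, PiLp.smul_apply, smul_eq_mul, u]
      linarith
    · calc ∑ l, (u + (s * σ k) • b k) l ≤ ∑ _l : Fin d, (1 / (d + 1) + s : ℝ) := by
            refine Finset.sum_le_sum fun l _ => ?_
            have h1 := (abs_le.1 (hterm l)).2
            simp only [PiLp.add_apply, PiLp.smul_apply, smul_eq_mul, u]
            linarith
        _ = (d * (d + 2)) / (d + 1) ^ 2 := by
          rw [Finset.sum_const, Finset.card_univ, Fintype.card_fin, nsmul_eq_mul, hs]
          field_simp
          ring
        _ ≤ 1 := by
          rw [div_le_one (by positivity)]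
          nlinarith

theorem Convex.interior_nonempty_of_addHaar_ne_zero {E : Type*} [NormedAddCommGroup E]
    [NormedSpace ℝ E] [MeasurableSpace E] [BorelSpace E] [FiniteDimensional ℝ E] (μ : Measure E)
    [μ.IsAddHaarMeasure] {s : Set E} (hs : Convex ℝ s) (h : μ s ≠ 0) : (interior s).Nonempty := by
  by_contra hi
  rw [Set.not_nonempty_iff_eq_empty] at hi
  refine h (measure_mono_null ?_ (hs.addHaar_frontier μ))
  rw [frontier, hi, Set.sdiff_empty]
  exact subset_closure

/-- The simplex with vertex `y none` and edges `y (some k)` at this vertex. -/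
def simplexBody {d : ℕ} (y : SimplexSpace d) : Set (EuclideanSpace ℝ (Fin d)) :=
  {x | ∃ a : EuclideanSpace ℝ (Fin d), (∀ k, 0 ≤ a k) ∧ ∑ k, a k ≤ 1 ∧
    x = y none + ∑ k, a k • y (some k)}

theorem exists_simplexBody_volume (d : ℕ) : ∃ κ > (0 : ℝ), ∀ ρ > (0 : ℝ),
    ∀ (y : SimplexSpace d) (C : Set (EuclideanSpace ℝ (Fin d))), Convex ℝ C →
      y ∈ triangularSimplices ρ C → simplexBody y ⊆ C ∧ Convex ℝ (simplexBody y) ∧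
        IsCompact (simplexBody y) ∧ (interior (simplexBody y)).Nonempty ∧
        ENNReal.ofReal (κ * ρ) ≤ volume (simplexBody y) := by
  let S₀ : Set (EuclideanSpace ℝ (Fin d)) := {a | (∀ k, 0 ≤ a k) ∧ ∑ k, a k ≤ 1}
  have hcont : ∀ k, Continuous fun a : EuclideanSpace ℝ (Fin d) => a k := fun k => by fun_prop
  have hS₀c : IsCompact S₀ := by
    refine Metric.isCompact_of_isClosed_isBounded ?_ ?_
    · refine IsClosed.inter (s₁ := {a : EuclideanSpace ℝ (Fin d) | ∀ k, 0 ≤ a k}) ?_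
        (isClosed_le (f := fun a : EuclideanSpace ℝ (Fin d) => ∑ k, a k) (by fun_prop)
          continuous_const)
      rw [Set.ofPred_forall]
      exact isClosed_iInter fun k => isClosed_le continuous_const (hcont k)
    · refine isBounded_iff_forall_norm_le.2 ⟨√(∑ _k : Fin d, 1), fun x hx => ?_⟩
      rw [EuclideanSpace.norm_eq]
      refine Real.sqrt_le_sqrt (Finset.sum_le_sum fun k _ => ?_)
      have h1 : x k ≤ 1 := (Finset.single_le_sum (f := fun k => x k) (fun l _ => hx.1 l)
        (Finset.mem_univ k)).trans hx.2
      rw [Real.norm_eq_abs, abs_of_nonneg (hx.1 k)]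
      exact pow_le_one₀ (hx.1 k) h1
  have hS₀v : 0 < volume S₀ := by
    refine Measure.measure_pos_of_nonempty_interior _ ⟨WithLp.toLp 2 fun _ => 1 / (d + 1 : ℝ), ?_⟩
    have hopen : IsOpen ({a : EuclideanSpace ℝ (Fin d) | ∀ k, 0 < a k} ∩ {a | ∑ k, a k < 1}) := by
      refine IsOpen.inter ?_ (isOpen_lt (by fun_prop) continuous_const)
      rw [Set.ofPred_forall]
      exact isOpen_iInter_of_finite fun k => isOpen_lt continuous_const (hcont k)
    refine interior_maximal (t := {a | ∀ k, 0 < a k} ∩ {a | ∑ k, a k < 1}) ?_ hopen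
      (Set.mem_inter (fun k => ?_) ?_)
    · rintro a ⟨ha, has⟩
      exact ⟨fun k => (ha k).le, le_of_lt has⟩
    · positivity
    · simp only [Set.mem_ofPred_eq, Finset.sum_const, Finset.card_univ, Fintype.card_fin,
        nsmul_eq_mul]
      rw [mul_one_div, div_lt_one (by positivity)]
      linarith
  have hS₀t : volume S₀ ≠ ⊤ := hS₀c.measure_lt_top.ne
  refine ⟨(volume S₀).toReal, ENNReal.toReal_pos hS₀v.ne' hS₀t, fun ρ hρ y C hC hy => ?_⟩
  obtain ⟨htri, hpos, hprod, hyC, hyeC⟩ := hy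
  let s := EuclideanSpace.basisFun (Fin d) ℝ
  let T : EuclideanSpace ℝ (Fin d) →ₗ[ℝ] EuclideanSpace ℝ (Fin d) :=
    s.toBasis.constr ℝ fun k => y (some k)
  have hTa : ∀ a : EuclideanSpace ℝ (Fin d), T a = ∑ k, a k • y (some k) := by
    intro a
    simp [T, s, Module.Basis.constr_apply_fintype]
  have himage : simplexBody y = (fun x => y none + x) '' (T '' S₀) := by
    ext x
    simp only [simplexBody, Set.mem_ofPred_eq, Set.mem_image, exists_exists_and_eq_and, hTa, S₀]
    constructor
    · rintro ⟨a, h1, h2, h3⟩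
      exact ⟨a, ⟨h1, h2⟩, h3.symm⟩
    · rintro ⟨a, ⟨h1, h2⟩, h3⟩
      exact ⟨a, h1, h2, h3.symm⟩
  have hS₀conv : Convex ℝ S₀ := by
    rintro a ⟨ha1, ha2⟩ b ⟨hb1, hb2⟩ u v hu hv huv
    refine ⟨fun k => ?_, ?_⟩
    · exact add_nonneg (mul_nonneg hu (ha1 k)) (mul_nonneg hv (hb1 k))
    · simp only [PiLp.add_apply, PiLp.smul_apply, smul_eq_mul, Finset.sum_add_distrib,
        ← Finset.mul_sum]
      nlinarith
  have hconv : Convex ℝ (simplexBody y) := by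
    rw [himage]
    exact (hS₀conv.linear_image T).translate (y none)
  have hdet : LinearMap.det T = ∏ k, y (some k) k := by
    have h1 : s.toBasis.det (T ∘ s.toBasis) = LinearMap.det T * s.toBasis.det s.toBasis :=
      Module.Basis.det_comp _ _ _
    rw [Module.Basis.det_self, mul_one] at h1
    have hTs : T ∘ s.toBasis = fun k => y (some k) := by
      ext1 k
      exact s.toBasis.constr_basis ℝ _ k
    rw [← h1, hTs, Module.Basis.det_apply, Matrix.det_of_isLowerTriangular]
    · simp [Module.Basis.toMatrix_apply, s]
    · intro i j hij
      simpa [Module.Basis.toMatrix_apply, s] using htri i j hij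
  have hvol : ENNReal.ofReal ((volume S₀).toReal * ρ) ≤ volume (simplexBody y) := by
    rw [himage, Set.image_add_left, measure_preimage_add, Measure.addHaar_image_linearMap, hdet,
      abs_of_pos (Finset.prod_pos fun k _ => hpos k), mul_comm, ENNReal.ofReal_mul hρ.le,
      ENNReal.ofReal_toReal hS₀t]
    gcongr
  refine ⟨?_, hconv, ?_, hconv.interior_nonempty_of_addHaar_ne_zero volume ?_, hvol⟩
  · rintro x ⟨a, ha0, has, rfl⟩
    let w : Option (Fin d) → ℝ := fun o => o.elim (1 - ∑ k, a k) fun k => a k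
    let p : Option (Fin d) → EuclideanSpace ℝ (Fin d) := fun i =>
      i.elim (y none) fun k => y none + y (some k)
    have : y none + ∑ k, a k • y (some k) = ∑ i, w i • p i := by
      rw [Fintype.sum_option]
      simp only [w, p, Option.elim, smul_add, Finset.sum_add_distrib, ← Finset.sum_smul]
      module
    rw [this]
    refine hC.sum_smul_mem_of_ne_zero ?_ ?_ ?_
    · rintro (_ | k)
      · exact sub_nonneg.2 has
      · exact ha0 k
    · rw [Fintype.sum_option]
      simp only [w, Option.elim]
      ring
    · rintro (_ | k) -
      · exact hyC
      · exact hyeC k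
  · rw [himage]
    exact (hS₀c.image T.continuous_of_finiteDimensional).image (by fun_prop)
  · refine ((ENNReal.ofReal_pos.2 ?_).trans_le hvol).ne'
    exact mul_pos (ENNReal.toReal_pos hS₀v.ne' hS₀t) hρ

theorem Convex.exists_finset_lt_addHaar_convexHull {E : Type*} [NormedAddCommGroup E]
    [NormedSpace ℝ E] [MeasurableSpace E] [BorelSpace E] [FiniteDimensional ℝ E] (μ : Measure E)
    [μ.IsAddHaarMeasure] {s : Set E} (hs : Convex ℝ s) {c : ENNReal} (hc : c < μ s) :
    ∃ u : Finset E, ↑u ⊆ s ∧ c < μ (convexHull ℝ (u : Set E)) := by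
  classical
  have hint : c < μ (interior s) := by
    refine hc.trans_le ((measure_mono ?_).trans
      ((measure_union_le (interior s) (frontier s)).trans_eq ?_))
    · rw [← closure_eq_interior_union_frontier]
      exact subset_closure
    · rw [hs.addHaar_frontier μ, add_zero]
  obtain ⟨k, hks, hk, hck⟩ := isOpen_interior.exists_lt_isCompact hint
  have hb : ∀ x ∈ k, ∃ b : Finset E, x ∈ interior (convexHull ℝ (b : Set E)) ∧
      convexHull ℝ (b : Set E) ⊆ s := by
    intro x hx
    obtain ⟨b, hxb, hbs⟩ := exists_mem_interior_convexHull_affineBasis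
      (mem_interior_iff_mem_nhds.1 (hks hx))
    exact ⟨Finset.univ.image b, by simpa using hxb, by simpa using hbs⟩
  choose! b hxb hbs using hb
  obtain ⟨t, htk⟩ := hk.elim_nhds_subcover' (fun x _ => convexHull ℝ (b x : Set E))
    fun x hx => mem_interior_iff_mem_nhds.1 (hxb x hx)
  refine ⟨t.biUnion fun x => b x, ?_, hck.trans_le (measure_mono (htk.trans ?_))⟩
  · simp only [Finset.coe_biUnion, Set.iUnion_subset_iff]
    exact fun x _ => (subset_convexHull ℝ _).trans (hbs x x.2)
  · simp only [Set.iUnion_subset_iff]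
    intro x hx
    refine convexHull_mono ?_
    simp only [Finset.coe_biUnion]
    exact Set.subset_biUnion_of_mem (u := fun x : k => (b x : Set E)) hx

/-- A finite family of convex sets can be shrunk to compact convex sets without losing more than
half of the volume of the intersections that have volume at least one. -/
theorem exists_compact_convex_subfamily {ι α E : Type*} [Finite ι] [Finite α] [Nonempty α]
    [NormedAddCommGroup E]
    [NormedSpace ℝ E] [MeasurableSpace E] [BorelSpace E] [FiniteDimensional ℝ E] (μ : Measure E)
    [μ.IsAddHaarMeasure] (K : ι → Set E) (hK : ∀ i, Convex ℝ (K i)) :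
    ∃ K' : ι → Set E, (∀ i, Convex ℝ (K' i)) ∧ (∀ i, IsCompact (K' i)) ∧ (∀ i, K' i ⊆ K i) ∧
      ∀ g : α → ι, 1 ≤ μ (⋂ s, K (g s)) → 1 / 2 ≤ μ (⋂ s, K' (g s)) := by
  have hu : ∀ g : α → ι, ∃ u : Finset E, ↑u ⊆ ⋂ s, K (g s) ∧
      (1 ≤ μ (⋂ s, K (g s)) → 1 / 2 ≤ μ (convexHull ℝ (u : Set E))) := by
    intro g
    by_cases h : 1 ≤ μ (⋂ s, K (g s))
    · obtain ⟨u, hu, huv⟩ := (convex_iInter fun s => hK (g s)).exists_finset_lt_addHaar_convexHull μ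
        (c := 1 / 2) (lt_of_lt_of_le (by simp [ENNReal.inv_lt_one]) h)
      exact ⟨u, hu, fun _ => huv.le⟩
    · exact ⟨∅, by simp, fun h' => absurd h' h⟩
  choose u hu huv using hu
  refine ⟨fun i => convexHull ℝ (⋃ g ∈ {g : α → ι | i ∈ Set.range g}, (u g : Set E)),
    fun i => convex_convexHull ℝ _, fun i => ?_, fun i => ?_, fun g hg => ?_⟩
  · exact ((Set.toFinite _).biUnion fun g _ => (u g).finite_toSet).isCompact_convexHull ℝ
  · refine convexHull_min (Set.iUnion₂_subset ?_) (hK i)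
    rintro g ⟨s, rfl⟩
    exact (hu g).trans (Set.iInter_subset _ s)
  · refine (huv g hg).trans (measure_mono (Set.subset_iInter fun s => convexHull_mono ?_))
    exact Set.subset_biUnion_of_mem (u := fun g => (u g : Set E)) ⟨s, rfl⟩

/-- A weighted fractional Helly theorem: if among any `P` of the sets there are `d + 2` all of
whose `(d + 1)`-wise intersections have large volume, then a simplex of large volume lies in a
positive fraction of the sets. -/
theorem exists_fractional_triangularSimplex (d : ℕ) (hd : 0 < d) : ∃ ρ > (0 : ℝ),
    ∀ P : ℕ, 0 < P → ∃ β > (0 : ℝ), ∀ (ι : Type) [Fintype ι]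
      (K : ι → Set (EuclideanSpace ℝ (Fin d)))
      [∀ (y : SimplexSpace d) i, Decidable (y ∈ triangularSimplices ρ (K i))],
      (∀ i, Convex ℝ (K i)) → (∀ i, IsCompact (K i)) →
      (∀ f : Fin P → ι, ∃ σ : Fin (d + 2) → Fin P, Function.Injective σ ∧
        ∀ t : Fin (d + 2), 1 / 2 ≤ volume (⋂ s : Fin (d + 1), K (f (σ (t.succAbove s))))) →
      ∀ w : ι → ℝ, (∀ i, 0 ≤ w i) → ∑ i, w i = 1 →
        ∃ y, β ≤ ∑ i, if y ∈ triangularSimplices ρ (K i) then w i else 0 := by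
  set η : ℝ := 1 / (4 * (d + 1)) * (1 / 8) ^ (d + 1) with hη
  have hη0 : 0 < η := by positivity
  have hη1 : η ≤ 1 := by
    refine mul_le_one₀ ?_ (by positivity) (pow_le_one₀ (by norm_num) (by norm_num))
    rw [div_le_one (by positivity)]
    have : (0 : ℝ) ≤ d := by positivity
    linarith
  obtain ⟨G, δ, hδ, hlist⟩ := exists_simplex_list d hd hη0 hη1
  refine ⟨(1 / (d + 1) ^ 2 : ℝ) ^ d * δ, by positivity, fun P hP => ?_⟩
  have : Nonempty (Finset.Icc (-G : ℤ) G) := ⟨⟨0, by simp⟩⟩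
  let γ := Fin d → Finset.Icc (-G : ℤ) G
  refine ⟨1 / ((P : ℝ) ^ (Fintype.card (Fin (d + 1)) + Fintype.card Unit) * Fintype.card γ), ?_,
    fun ι _ K _ hK hKc hf w hw hs => ?_⟩
  · have : (0 : ℝ) < Fintype.card γ := by exact_mod_cast Fintype.card_pos
    positivity
  have hN : ∀ h : Fin (d + 1) → ι, ∃ N : γ → SimplexSpace d, 1 / 2 ≤ volume (⋂ s, K (h s)) →
      ∀ c : ℝ, 0 ≤ c → c ≤ 1 → ∀ z ∈ ⋂ s, K (h s), ∀ y ∈ ⋂ s, K (h s), ∃ g,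
        ∀ C : Set (EuclideanSpace ℝ (Fin d)), Convex ℝ C →
          (∀ x ∈ ⋂ s, K (h s), (1 + c) • z - c • y + η • (x - z) ∈ C) →
          N g ∈ triangularSimplices ((1 / (d + 1) ^ 2 : ℝ) ^ d * δ) C := by
    intro h
    by_cases hvol : 1 / 2 ≤ volume (⋂ s, K (h s))
    · have hconv : Convex ℝ (⋂ s, K (h s)) := convex_iInter fun s => hK _
      obtain ⟨T, hT, q, hq⟩ := hlist (⋂ s, K (h s)) (IsCompact.iInter_of_nonempty fun s => hKc _)
        (hconv.interior_nonempty_of_addHaar_ne_zero volume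
          (lt_of_lt_of_le (by simp) hvol).ne') hvol
      choose N hN using fun g => exists_triangularSimplex hδ T hT (q g)
      refine ⟨N, fun _ c hc0 hc1 z hz y hy => ?_⟩
      obtain ⟨g, hg⟩ := hq c hc0 hc1 z hz y hy
      exact ⟨g, fun C hC hx => hN g C hC (hg C hC hx).1 (hg C hC hx).2⟩
    · exact ⟨fun _ => 0, fun h' => absurd h' hvol⟩
  choose N hN using hN
  obtain ⟨y, hy⟩ := exists_le_of_forall_resample (κ := Unit) w hw hs P hP N
    (fun y g => y ∈ triangularSimplices ((1 / (d + 1) ^ 2 : ℝ) ^ d * δ) (K (g ()))) (by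
      intro f
      obtain ⟨σ, hσ, hvol⟩ := hf f
      obtain ⟨t, z, hz, y, hy, hx⟩ := exists_homothet_subset (fun s => K (f (σ s)))
        (fun s => hK _) (fun s => hKc _) fun t =>
          (convex_iInter fun s => hK _).interior_nonempty_of_addHaar_ne_zero volume
            (lt_of_lt_of_le (by simp) (hvol t)).ne'
      obtain ⟨g, hg⟩ := hN (f ∘ fun s => σ (t.succAbove s)) (hvol t) (1 / (2 * (d + 1)))
        (by positivity) (by
          rw [div_le_one (by positivity)]
          have : (0 : ℝ) ≤ d := by positivity
          linarith) z hz y hy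
      exact ⟨fun s => σ (t.succAbove s), fun _ => σ t, fun _ _ _ => rfl,
        fun s _ hst => t.succAbove_ne s (hσ hst), g, hg _ (hK _) hx⟩)
  refine ⟨y, hy.trans_eq ?_⟩
  exact Fintype.sum_equiv (Equiv.funUnique Unit ι) _ _ fun g => by simp; rfl

/-- If every `p` elements contain a good `k`-subset and singletons are good, then any long enough
sequence has `k + 1` positions, any `k` of which carry a good set of values. -/
theorem exists_injective_forall_succAbove (k p : ℕ) (hk : 0 < k) : ∃ P > 0,
    ∀ (X : Type) [DecidableEq X] (good : Finset X → Prop), (∀ x, good {x}) →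
      (∀ A : Finset X, A.card = p → ∃ Q ⊆ A, Q.card = k ∧ good Q) →
      ∀ f : Fin P → X, ∃ σ : Fin (k + 1) → Fin P, Function.Injective σ ∧
        ∀ t : Fin (k + 1), good (Finset.univ.image fun s : Fin k => f (σ (t.succAbove s))) := by
  obtain ⟨N, hN⟩ := exists_ramsey_number k (k + 1) (p * k)
  refine ⟨N + 1, N.succ_pos, fun X _ good h1 hA f => ?_⟩
  rcases hN _ Finset.univ (fun u => good (u.image f)) (by simp) with
    ⟨t, -, htc, ht⟩ | ⟨t, -, htc, ht⟩
  · let σ := t.orderEmbOfFin htc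
    refine ⟨σ, σ.injective, fun l => ?_⟩
    have := ht (Finset.univ.image fun s : Fin k => σ (l.succAbove s)) ?_ ?_
    · rwa [Finset.image_image] at this
    · intro x hx
      obtain ⟨s, -, rfl⟩ := Finset.mem_image.1 hx
      exact t.orderEmbOfFin_mem htc _
    · refine (Finset.card_image_of_injective _
        (σ.injective.comp (Fin.succAbove_right_injective (p := l)))).trans ?_
      simp
  · exfalso
    rcases le_or_gt p (t.image f).card with hp | hp
    · obtain ⟨A, hAt, hAc⟩ := Finset.exists_subset_card_eq hp
      obtain ⟨Q, hQA, hQc, hQ⟩ := hA A hAc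
      have hpre : ∀ x : Q, ∃ a ∈ t, f a = x := fun x => Finset.mem_image.1 (hAt (hQA x.2))
      choose g hgt hg using hpre
      have hginj : Function.Injective g := fun x y hxy => Subtype.ext (by rw [← hg, ← hg, hxy])
      refine ht (Finset.univ.image g) ?_ ?_ ?_
      · intro a ha
        obtain ⟨x, -, rfl⟩ := Finset.mem_image.1 ha
        exact hgt x
      · rw [Finset.card_image_of_injective _ hginj]
        simpa using hQc
      · convert hQ using 1
        ext x
        simp [hg]
    · have hne : (t.image f).Nonempty := by
        rw [Finset.image_nonempty, ← Finset.card_pos, htc]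
        exact Nat.mul_pos (by lia) hk
      obtain ⟨x, -, hx⟩ := Finset.exists_le_card_fiber_of_mul_le_card_of_maps_to
        (fun a ha => Finset.mem_image_of_mem f ha) hne
        (htc.symm ▸ Nat.mul_le_mul_right k hp.le)
      obtain ⟨u, hu, huc⟩ := Finset.exists_subset_card_eq hx
      refine ht u (hu.trans (Finset.filter_subset _ _)) huc ?_
      convert h1 x using 1
      refine Finset.eq_singleton_iff_nonempty_unique_mem.2 ⟨?_, ?_⟩
      · rw [Finset.image_nonempty, ← Finset.card_pos, huc]
        exact hk
      · intro y hy
        obtain ⟨a, ha, rfl⟩ := Finset.mem_image.1 hy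
        exact (Finset.mem_filter.1 (hu ha)).2

/-- Quantitative (p, d+1) theorem: volume version. -/
theorem quantitative_pq_theorem (d : ℕ) (hd : 0 < d) :
    ∃ v > (0 : ℝ),
      ∀ p : ℕ, d + 1 ≤ p →
      ∃ r : ℕ,
      ∀ F : Finset (Set (EuclideanSpace ℝ (Fin d))),
        (∀ C ∈ F, Convex ℝ C ∧ 1 ≤ volume C) →
        (∀ P ⊆ F, P.card = p →
          ∃ Q ⊆ P, Q.card = d + 1 ∧
            1 ≤ volume (⋂₀ (Q : Set (Set (EuclideanSpace ℝ (Fin d)))))) →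
        ∃ T : Finset (Set (EuclideanSpace ℝ (Fin d))),
          T.card ≤ r ∧
          (∀ K ∈ T, Convex ℝ K ∧ IsCompact K ∧ (interior K).Nonempty ∧
            ENNReal.ofReal v ≤ volume K) ∧
          (∀ C ∈ F, ∃ K ∈ T, K ⊆ C) := by
  classical
  obtain ⟨κ, hκ, hbody⟩ := exists_simplexBody_volume d
  obtain ⟨ρ, hρ, hfrac⟩ := exists_fractional_triangularSimplex d hd
  refine ⟨κ * ρ, mul_pos hκ hρ, fun p _ => ?_⟩
  obtain ⟨P, hP, hpos⟩ := exists_injective_forall_succAbove (d + 1) p d.succ_pos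
  obtain ⟨β, hβ, hfrac⟩ := hfrac P hP
  obtain ⟨r, hr⟩ := exists_transversal_size (SimplexSpace d) hβ
  refine ⟨r, fun F hF hpq => ?_⟩
  obtain ⟨K, hK, hKc, hKF, hKvol⟩ := exists_compact_convex_subfamily (α := Fin (d + 1)) volume
    (fun C : F => (C : Set (EuclideanSpace ℝ (Fin d)))) fun C => (hF C C.2).1
  -- every long sequence of members has `d + 2` terms with large `(d + 1)`-wise intersections
  have hseq : ∀ f : Fin P → F, ∃ σ : Fin (d + 2) → Fin P, Function.Injective σ ∧
      ∀ t : Fin (d + 2), 1 / 2 ≤ volume (⋂ s : Fin (d + 1), K (f (σ (t.succAbove s)))) := by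
    intro f
    obtain ⟨σ, hσ, hgood⟩ := hpos F
      (fun Q => 1 ≤ volume (⋂ C ∈ Q, (C : Set (EuclideanSpace ℝ (Fin d)))))
      (fun C => by simpa using (hF C C.2).2)
      (fun A hA => by
        obtain ⟨Q, hQA, hQc, hQ⟩ := hpq (A.map (Function.Embedding.subtype _))
          (fun C hC => by
            obtain ⟨C', -, rfl⟩ := Finset.mem_map.1 hC
            exact C'.2) (by rwa [Finset.card_map])
        obtain ⟨Q', hQ'A, rfl⟩ := Finset.subset_map_iff.1 hQA
        refine ⟨Q', hQ'A, by rwa [Finset.card_map] at hQc, hQ.trans_eq ?_⟩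
        congr 1
        ext x
        simp) f
    refine ⟨σ, hσ, fun t => hKvol _ ((hgood t).trans_eq ?_)⟩
    congr 1
    ext x
    simp
  obtain ⟨N, hNr, hN⟩ := hr F (fun C => triangularSimplices ρ (K C))
    (fun C => convex_triangularSimplices hρ (hK C)) (hfrac F K hK hKc hseq)
  refine ⟨(N.filter fun y => ∃ C, y ∈ triangularSimplices ρ (K C)).image simplexBody,
    Finset.card_image_le.trans ((Finset.card_filter_le _ _).trans hNr), ?_, fun C hC => ?_⟩
  · intro S hS
    obtain ⟨y, hy, rfl⟩ := Finset.mem_image.1 hS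
    obtain ⟨C, hyC⟩ := (Finset.mem_filter.1 hy).2
    exact (hbody ρ hρ y (K C) (hK C) hyC).2
  · obtain ⟨y, hyN, hy⟩ := hN ⟨C, hC⟩
    exact ⟨simplexBody y, Finset.mem_image_of_mem _ (Finset.mem_filter.2 ⟨hyN, _, hy⟩),
      (hbody ρ hρ y _ (hK _) hy).1.trans (hKF _)⟩
end

section
/- Given positive integers d and s, there exist a positive integer N = N(d,s) and δ = δ(d,s) > 0 such that the following holds: if (F_1, …, F_{d+1}) is an (m,1,s,δ)-rainbow (d+1)-tuple of families of convex sets in ℝ^d, then m < N. -/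
open MeasureTheory

/-- A (d+1)-tuple of families of convex sets in ℝ^d is (m, α, s, ε)-rainbow if each family
has m members, every colorful selection has intersection of volume at least α, and any s
distinct members of a single family have intersection of volume at most ε. -/
def IsRainbow (d m s : ℕ) (α ε : ℝ)
    (F : Fin (d + 1) → Finset (Set (EuclideanSpace ℝ (Fin d)))) : Prop :=
  (∀ i, ∀ A ∈ F i, Convex ℝ A) ∧
  (∀ i, (F i).card = m) ∧
  (∀ A : Fin (d + 1) → Set (EuclideanSpace ℝ (Fin d)),
    (∀ i, A i ∈ F i) → ENNReal.ofReal α ≤ volume (⋂ i, A i)) ∧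
  (∀ i, ∀ B ⊆ F i, B.card = s →
    volume (⋂₀ (B : Set (Set (EuclideanSpace ℝ (Fin d))))) ≤ ENNReal.ofReal ε)

/-- Product Ramsey theorem: a bounded coloring of a large grid is constant on a large subgrid. -/
theorem exists_monochromatic_subgrid (n : ℕ) : ∀ q t : ℕ, ∃ M : ℕ,
    ∀ (κ : Type) [Fintype κ], Fintype.card κ ≤ q →
    ∀ (α : Type) (S : Fin n → Finset α), (∀ i, M ≤ (S i).card) →
    ∀ c : (Fin n → α) → κ, ∃ T : Fin n → Finset α,
      (∀ i, T i ⊆ S i) ∧ (∀ i, t ≤ (T i).card) ∧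
      ∃ k, ∀ D : Fin n → α, (∀ i, D i ∈ T i) → c D = k := by
  induction n with
  | zero =>
    intro q t
    refine ⟨0, fun κ _ _ α S _ c =>
      ⟨S, fun i => i.elim0, fun i => i.elim0, c (fun i => i.elim0), ?_⟩⟩
    intro D _
    congr 1
    exact Subsingleton.elim _ _
  | succ n ih =>
    intro q t
    obtain ⟨M, hM⟩ := ih (q ^ (q * t + 1)) t
    refine ⟨max M (q * t + 1), fun κ _ hκ α S hS c => ?_⟩
    classical
    obtain ⟨S₀, hS₀, hcard⟩ := Finset.exists_subset_card_eq ((le_max_right _ _).trans (hS 0))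
    have hcol : Fintype.card (S₀ → κ) ≤ q ^ (q * t + 1) := by
      rw [Fintype.card_fun, Fintype.card_coe, hcard]
      exact Nat.pow_le_pow_left hκ _
    obtain ⟨T, hTS, hT, φ, hφ⟩ := hM (S₀ → κ) hcol α (fun i => S i.succ)
      (fun i => (le_max_left _ _).trans (hS _))
      (fun D a => c (Fin.cons (a : α) D))
    obtain ⟨k, -, hk⟩ := Finset.exists_lt_card_fiber_of_mul_lt_card_of_maps_to
      (s := (Finset.univ : Finset S₀)) (t := (Finset.univ : Finset κ)) (f := φ) (n := t)
      (fun _ _ => Finset.mem_univ _) (by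
        rw [Finset.card_univ, Finset.card_univ, Fintype.card_coe, hcard]
        exact Nat.lt_succ_of_le (Nat.mul_le_mul_right _ hκ))
    refine ⟨Fin.cons ((Finset.univ.filter fun a => φ a = k).map (Function.Embedding.subtype _)) T,
      ?_, ?_, k, ?_⟩
    · intro i
      refine Fin.cases ?_ (fun i => ?_) i
      · intro a ha
        simp only [Fin.cons_zero, Finset.mem_map] at ha
        obtain ⟨b, -, rfl⟩ := ha
        exact hS₀ b.2
      · simpa using hTS i
    · intro i
      refine Fin.cases ?_ (fun i => ?_) i
      · simpa using hk.le
      · simpa using hT i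
    · intro D hD
      have h0 := hD 0
      simp only [Fin.cons_zero, Finset.mem_map, Finset.mem_filter, Finset.mem_univ,
        true_and] at h0
      obtain ⟨a, ha, haD⟩ := h0
      have := congrFun (hφ (Fin.tail D) fun i => by simpa [Fin.tail] using hD i.succ) a
      rw [← ha, ← this]
      congr 1
      conv_lhs => rw [← Fin.cons_self_tail D]
      rw [← haD]; rfl

/-- Compact convex sets with empty intersection lie in closed half-spaces with empty
intersection. -/
theorem exists_separating_halfSpaces {γ E : Type*} [Fintype γ] [NormedAddCommGroup E]
    [NormedSpace ℝ E] [FiniteDimensional ℝ E] (Z : γ → Set E)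
    (hconv : ∀ g, Convex ℝ (Z g)) (hcomp : ∀ g, IsCompact (Z g)) (hne : ∀ g, (Z g).Nonempty)
    (hemp : ⋂ g, Z g = ∅) :
    ∃ (f : γ → E →ₗ[ℝ] ℝ) (a : γ → ℝ),
      (∀ g, ∀ z ∈ Z g, f g z ≤ a g) ∧ ∀ y, ∃ g, a g < f g y := by
  classical
  let diag : E →ₗ[ℝ] (γ → E) := LinearMap.pi fun _ => LinearMap.id
  have hclosed : IsClosed (LinearMap.range diag : Set (γ → E)) :=
    Submodule.closed_of_finiteDimensional _
  have hdisj : Disjoint (Set.univ.pi Z) (LinearMap.range diag : Set (γ → E)) := by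
    rw [Set.disjoint_left]
    rintro _ hy ⟨y, rfl⟩
    have : y ∈ ⋂ g, Z g := Set.mem_iInter.2 fun g => hy g trivial
    rw [hemp] at this
    exact this
  obtain ⟨f, u, v, hu, huv, hv⟩ := geometric_hahn_banach_compact_closed
    (convex_pi fun g _ => hconv g) (isCompact_univ_pi hcomp)
    (LinearMap.range diag).convex hclosed hdisj
  have hv0 : v < 0 := by simpa using hv 0 (Submodule.zero_mem _)
  have hdiag : ∀ y, f (diag y) = 0 := by
    intro y
    by_contra h
    have := hv (diag ((v / f (diag y)) • y)) ⟨_, rfl⟩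
    rw [map_smul, map_smul, smul_eq_mul, div_mul_cancel₀ _ h] at this
    exact lt_irrefl _ this
  have hsum : ∀ z : γ → E, f z = ∑ g, f (Pi.single g (z g)) := by
    intro z
    conv_lhs => rw [← Finset.univ_sum_single z]
    rw [map_sum]
  have hcont : ∀ g, Continuous fun y : E => f (Pi.single g y) := fun g =>
    f.continuous.comp (continuous_single (A := fun _ => E) g)
  choose z hz hmax using fun g => (hcomp g).exists_isMaxOn (hne g) (hcont g).continuousOn
  refine ⟨fun g => f.toLinearMap ∘ₗ LinearMap.single ℝ (fun _ => E) g,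
    fun g => f (Pi.single g (z g)), fun g y hy => hmax g hy, fun y => ?_⟩
  by_contra! h
  have h1 := Finset.sum_le_sum fun g (_ : g ∈ Finset.univ) => h g
  have h2 : ∑ g, f (Pi.single g y) = 0 := by
    rw [← hdiag y, hsum]; rfl
  have h3 := hu z fun g _ => hz g
  rw [hsum] at h3
  simp only [LinearMap.comp_apply, LinearMap.coe_single, ContinuousLinearMap.coe_coe] at h1
  linarith

/-- The cells of the grid `S` whose `i`-th coordinate is `b`. -/
def gridSlice {n : ℕ} {α : Type} (S : Fin n → Finset α) (i : Fin n) (b : α) : Set (Fin n → α) :=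
  {D | (∀ c, D c ∈ S c) ∧ D i = b}

theorem gridSlice_mono {n : ℕ} {α : Type} {S T : Fin n → Finset α} (h : ∀ c, T c ⊆ S c)
    (i : Fin n) (b : α) : gridSlice T i b ⊆ gridSlice S i b :=
  fun _ hD => ⟨fun c => h c (hD.1 c), hD.2⟩

/-- The points `x D` of the grid `S` are separated in direction `i` if distinct slices
orthogonal to that direction have disjoint convex hulls. -/
def IsSeparated {n : ℕ} {α E : Type} [AddCommGroup E] [Module ℝ E] (x : (Fin n → α) → E)
    (S : Fin n → Finset α) (i : Fin n) : Prop :=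
  ∀ b ∈ S i, ∀ r ∈ S i, b ≠ r →
    Disjoint (convexHull ℝ (x '' gridSlice S i b)) (convexHull ℝ (x '' gridSlice S i r))

theorem IsSeparated.mono {n : ℕ} {α E : Type} [AddCommGroup E] [Module ℝ E]
    {x : (Fin n → α) → E} {S T : Fin n → Finset α} {i : Fin n} (h : IsSeparated x S i)
    (hT : ∀ c, T c ⊆ S c) : IsSeparated x T i := fun b hb r hr hbr =>
  (h b (hT i hb) r (hT i hr) hbr).mono
    (convexHull_mono (Set.image_mono (gridSlice_mono hT i b)))
    (convexHull_mono (Set.image_mono (gridSlice_mono hT i r)))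

/-- Every `s` of the convex sets `A j` have an intersection whose complement is covered, as far as
the points `x D` are concerned, by convex sets indexed by `κ`. -/
def HasConvexAvoidance {n : ℕ} {α E : Type} [AddCommGroup E] [Module ℝ E] (κ : Type) (s : ℕ)
    (x : (Fin n → α) → E) (A : α → Set E) : Prop :=
  ∀ G : Finset α, G.card = s → ∃ H : κ → Set E, (∀ k, Convex ℝ (H k)) ∧
    (∀ D, ∃ k, x D ∈ H k) ∧ ∀ k, (⋂ j ∈ G, A j) ∩ H k = ∅

/-- Given a group of `s` members in direction `i`, on a large subgrid one of them can be separated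
by an affine functional from all remaining members. -/
theorem exists_separated_member {n s : ℕ} (hs : 0 < s) (κ : Type) [Fintype κ] (t : ℕ) :
    ∃ M : ℕ, ∀ (α E : Type) [Fintype α] [NormedAddCommGroup E] [NormedSpace ℝ E]
      [FiniteDimensional ℝ E] (x : (Fin n → α) → E) (A : α → Set E) (i : Fin n),
      (∀ j, Convex ℝ (A j)) → (∀ D, x D ∈ A (D i)) → HasConvexAvoidance κ s x A →
      ∀ S : Fin n → Finset α, (∀ c, M ≤ (S c).card) →
      ∃ T : Fin n → Finset α, (∀ c, T c ⊆ S c) ∧ (∀ c, t ≤ (T c).card) ∧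
        ∃ j ∈ S i, j ∉ T i ∧ ∃ (f : E →ₗ[ℝ] ℝ) (a : ℝ),
          (∀ D, (∀ c, c ≠ i → D c ∈ T c) → D i = j → f (x D) ≤ a) ∧
          ∀ D, (∀ c, D c ∈ T c) → a < f (x D) := by
  classical
  obtain ⟨M₂, hM₂⟩ := exists_monochromatic_subgrid n s t
  obtain ⟨M₁, hM₁⟩ := exists_monochromatic_subgrid n (Fintype.card κ ^ s) (M₂ + 1)
  refine ⟨M₁ + s, fun α E _ _ _ _ x A i hA hx hcov S hS => ?_⟩
  obtain ⟨G, hGS, hGs⟩ := Finset.exists_subset_card_eq ((Nat.le_add_left s M₁).trans (hS i))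
  obtain ⟨H, hHconv, hHcov, hHemp⟩ := hcov G hGs
  choose label hlabel using hHcov
  have hcard₁ : Fintype.card (G → κ) ≤ Fintype.card κ ^ s := by
    rw [Fintype.card_fun, Fintype.card_coe, hGs]
  have hS₀ : ∀ c, M₁ ≤ (Function.update S i (S i \ G) c).card := by
    intro c
    by_cases hc : c = i
    · subst hc
      rw [Function.update_self, Finset.card_sdiff_of_subset hGS, hGs]
      have := hS c
      omega
    · rw [Function.update_of_ne hc]
      exact (Nat.le_add_right _ _).trans (hS c)
  obtain ⟨S₁, hS₁S, hS₁, k, hk⟩ := hM₁ (G → κ) hcard₁ α _ hS₀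
    (fun D g => label (Function.update D i (g : α)))
  have hS₁G : S₁ i ⊆ S i \ G := by simpa using hS₁S i
  have hS₁S' : ∀ c, S₁ c ⊆ S c := by
    intro c
    by_cases hc : c = i
    · subst hc
      exact hS₁G.trans Finset.sdiff_subset
    · simpa [hc] using hS₁S c
  have hne : ∀ c, (S₁ c).Nonempty := fun c =>
    Finset.card_pos.1 ((Nat.succ_pos _).trans_le (hS₁ c))
  choose p hp using hne
  let P : G → Set (Fin n → α) := fun g => {D | (∀ c, c ≠ i → D c ∈ S₁ c) ∧ D i = g}
  have hPne : ∀ g, (P g).Nonempty := fun g =>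
    ⟨Function.update p i (g : α), fun c hc => by simpa [hc] using hp c, by simp⟩
  have hP : ∀ g, ∀ D ∈ P g, x D ∈ A g ∩ H (k g) := by
    rintro g D ⟨hD, hDi⟩
    refine ⟨hDi ▸ hx D, ?_⟩
    have h1 := congrFun (hk (Function.update D i (p i)) fun c => by
      by_cases hc : c = i
      · subst hc; simpa using hp c
      · simpa [hc] using hD c hc) g
    simp only [Function.update_idem] at h1
    rw [← hDi, Function.update_eq_self] at h1
    rw [← h1]
    exact hlabel D
  have hZ : ∀ g, convexHull ℝ (x '' P g) ⊆ A g ∩ H (k g) := fun g =>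
    convexHull_min (Set.image_subset_iff.2 (hP g)) ((hA g).inter (hHconv _))
  have hGne : G.Nonempty := Finset.card_pos.1 (hGs ▸ hs)
  obtain ⟨g₀, hg₀⟩ := hGne
  obtain ⟨f, a, hfa, hfy⟩ := exists_separating_halfSpaces (fun g => convexHull ℝ (x '' P g))
    (fun g => convex_convexHull ℝ _)
    (fun g => ((Set.toFinite (P g)).image x).isCompact_convexHull (𝕜 := ℝ))
    (fun g => ((hPne g).image x).mono (subset_convexHull ℝ _))
    (by
      rw [Set.eq_empty_iff_forall_notMem]
      intro y hy
      rw [Set.mem_iInter] at hy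
      have : y ∈ (⋂ j ∈ G, A j) ∩ H (k ⟨g₀, hg₀⟩) :=
        ⟨Set.mem_iInter₂.2 fun j hj => (hZ ⟨j, hj⟩ (hy ⟨j, hj⟩)).1, (hZ _ (hy ⟨g₀, hg₀⟩)).2⟩
      rw [hHemp] at this
      exact this)
  choose w hw using hfy
  obtain ⟨T, hTS, hT, j, hj⟩ := hM₂ G (by rw [Fintype.card_coe, hGs]) α S₁
    (fun c => (Nat.le_succ _).trans (hS₁ c)) (fun D => w (x D))
  refine ⟨T, fun c => (hTS c).trans (hS₁S' c), hT, j, hGS j.2,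
    fun h => (Finset.mem_sdiff.1 (hS₁G (hTS i h))).2 j.2, f j, a j, fun D hD hDi => ?_,
    fun D hD => ?_⟩
  · exact hfa j _ (subset_convexHull ℝ _ ⟨D, ⟨fun c hc => hTS c (hD c hc), hDi⟩, rfl⟩)
  · rw [← hj D hD]
    exact hw (x D)

/-- A large grid has a subgrid separated in a given direction. -/
theorem exists_subgrid_isSeparated {n s : ℕ} (hs : 0 < s) (κ : Type) [Fintype κ] (t m : ℕ) :
    ∃ M : ℕ, ∀ (α E : Type) [Fintype α] [NormedAddCommGroup E] [NormedSpace ℝ E]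
      [FiniteDimensional ℝ E] (x : (Fin n → α) → E) (A : α → Set E) (i : Fin n),
      (∀ j, Convex ℝ (A j)) → (∀ D, x D ∈ A (D i)) → HasConvexAvoidance κ s x A →
      ∀ S : Fin n → Finset α, (∀ c, M ≤ (S c).card) →
      ∃ T : Fin n → Finset α, (∀ c, T c ⊆ S c) ∧ (∀ c, c ≠ i → t ≤ (T c).card) ∧
        m ≤ (T i).card ∧ IsSeparated x T i := by
  classical
  induction m with
  | zero =>
    refine ⟨t, fun α E _ _ _ _ x A i _ _ _ S hS =>
      ⟨Function.update S i ∅, fun c => ?_, fun c hc => ?_, Nat.zero_le _, fun b hb => ?_⟩⟩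
    · by_cases hc : c = i
      · subst hc; simp
      · simp [hc]
    · simpa [hc] using hS c
    · simp at hb
  | succ m ih =>
    obtain ⟨M, hM⟩ := ih
    obtain ⟨M', hM'⟩ := exists_separated_member (n := n) hs κ M
    refine ⟨M', fun α E _ _ _ _ x A i hA hx hcov S hS => ?_⟩
    obtain ⟨S', hS'S, hS', j, hjS, hjS', f, a, hle, hlt⟩ := hM' α E x A i hA hx hcov S hS
    obtain ⟨T, hTS', hTt, hTm, hsep⟩ := hM α E x A i hA hx hcov S' hS'
    have hjT : j ∉ T i := fun h => hjS' (hTS' i h)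
    set T' := Function.update T i (insert j (T i)) with hT'
    have hT'i : T' i = insert j (T i) := by simp [hT']
    have hT'c : ∀ c, c ≠ i → T' c = T c := fun c hc => by simp [hT', hc]
    have hslice : ∀ b ∈ T i, gridSlice T' i b ⊆ gridSlice T i b := by
      rintro b hb D ⟨hD, rfl⟩
      refine ⟨fun c => ?_, rfl⟩
      by_cases hc : c = i
      · subst hc; exact hb
      · exact hT'c c hc ▸ hD c
    have hullj : convexHull ℝ (x '' gridSlice T' i j) ⊆ {y | f y ≤ a} := by
      refine convexHull_min ?_ (convex_halfSpace_le f.isLinear a)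
      rintro _ ⟨D, ⟨hD, hDi⟩, rfl⟩
      exact hle D (fun c hc => hTS' c (hT'c c hc ▸ hD c)) hDi
    have hull : ∀ b ∈ T i, convexHull ℝ (x '' gridSlice T' i b) ⊆ {y | a < f y} := by
      intro b hb
      refine convexHull_min ?_ (convex_halfSpace_gt f.isLinear a)
      rintro _ ⟨D, hD, rfl⟩
      exact hlt D fun c => hTS' c ((hslice b hb hD).1 c)
    have hdisj : ∀ b ∈ T i, Disjoint (convexHull ℝ (x '' gridSlice T' i j))
        (convexHull ℝ (x '' gridSlice T' i b)) := fun b hb =>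
      Set.disjoint_left.2 fun y hy hy' => not_lt.2 (show f y ≤ a from hullj hy) (hull b hb hy')
    refine ⟨T', fun c => ?_, fun c hc => ?_, ?_, ?_⟩
    · by_cases hc : c = i
      · subst hc
        rw [hT'i]
        exact Finset.insert_subset hjS ((hTS' c).trans (hS'S c))
      · rw [hT'c c hc]
        exact (hTS' c).trans (hS'S c)
    · rw [hT'c c hc]
      exact hTt c hc
    · rw [hT'i, Finset.card_insert_of_notMem hjT]
      exact Nat.succ_le_succ hTm
    · intro b hb r hr hbr
      rw [hT'i, Finset.mem_insert] at hb hr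
      rcases hb with rfl | hb <;> rcases hr with rfl | hr
      · exact absurd rfl hbr
      · exact hdisj r hr
      · exact (hdisj b hb).symm
      · exact (hsep b hb r hr hbr).mono
          (convexHull_mono (Set.image_mono (hslice b hb)))
          (convexHull_mono (Set.image_mono (hslice r hr)))

/-- A large grid has a subgrid separated in every direction of `C`. -/
theorem exists_subgrid_forall_isSeparated {n s : ℕ} (hs : 0 < s) (κ : Type) [Fintype κ] (t : ℕ)
    (C : Finset (Fin n)) :
    ∃ M : ℕ, ∀ (α E : Type) [Fintype α] [NormedAddCommGroup E] [NormedSpace ℝ E]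
      [FiniteDimensional ℝ E] (x : (Fin n → α) → E) (A : Fin n → α → Set E),
      (∀ i j, Convex ℝ (A i j)) → (∀ i D, x D ∈ A i (D i)) →
      (∀ i, HasConvexAvoidance κ s x (A i)) →
      ∀ S : Fin n → Finset α, (∀ c, M ≤ (S c).card) →
      ∃ T : Fin n → Finset α, (∀ c, T c ⊆ S c) ∧ (∀ c, t ≤ (T c).card) ∧
        ∀ i ∈ C, IsSeparated x T i := by
  induction C using Finset.induction_on with
  | empty =>
    exact ⟨t, fun α E _ _ _ _ x A _ _ _ S hS => ⟨S, fun c => subset_rfl, hS, by simp⟩⟩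
  | insert i C _ ih =>
    obtain ⟨M, hM⟩ := ih
    obtain ⟨M', hM'⟩ := exists_subgrid_isSeparated (n := n) hs κ M M
    refine ⟨M', fun α E _ _ _ _ x A hA hx hcov S hS => ?_⟩
    obtain ⟨S', hS'S, hS't, hS'm, hsep⟩ := hM' α E x (A i) i (hA i) (hx i) (hcov i) S hS
    obtain ⟨T, hTS', hT, hsep'⟩ := hM α E x A hA hx hcov S' fun c => by
      by_cases hc : c = i
      · exact hc ▸ hS'm
      · exact hS't c hc
    refine ⟨T, fun c => (hTS' c).trans (hS'S c), hT, fun c hc => ?_⟩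
    rcases Finset.mem_insert.1 hc with rfl | hc
    · exact hsep.mono hTS'
    · exact hsep' c hc

/-- Affine functionals in number exceeding the dimension cannot attain all sign patterns. -/
theorem not_forall_sign_pattern {d : ℕ} {E : Type*} [NormedAddCommGroup E] [NormedSpace ℝ E]
    [FiniteDimensional ℝ E] (hd : Module.finrank ℝ E = d) (f : Fin (d + 1) → E →ₗ[ℝ] ℝ)
    (a : Fin (d + 1) → ℝ) :
    ¬ ∀ σ : Fin (d + 1) → Prop, ∃ y, ∀ i, (σ i → f i y < a i) ∧ (¬ σ i → a i < f i y) := by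
  intro h
  have hdep : ¬ LinearIndependent ℝ f := fun hli => by
    have := hli.fintype_card_le_finrank
    rw [Fintype.card_fin, Module.finrank_linearMap, Module.finrank_self, hd] at this
    omega
  obtain ⟨c, hc, i₀, hi₀⟩ := Fintype.not_linearIndependent_iff.1 hdep
  have hzero : ∀ y, ∑ i, c i * f i y = 0 := fun y => by
    simpa using LinearMap.congr_fun hc y
  obtain ⟨y, hy⟩ := h fun i => 0 < c i
  obtain ⟨z, hz⟩ := h fun i => ¬ 0 < c i
  have key : ∀ i, c i * f i y ≤ c i * f i z ∧ (c i ≠ 0 → c i * f i y < c i * f i z) := by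
    intro i
    rcases lt_trichotomy (c i) 0 with hi | hi | hi
    · have h1 := (hy i).2 hi.not_gt
      have h2 := (hz i).1 hi.not_gt
      have := mul_lt_mul_of_neg_left (h2.trans h1) hi
      exact ⟨this.le, fun _ => this⟩
    · simp [hi]
    · have h1 := (hy i).1 hi
      have h2 := (hz i).2 (not_not.2 hi)
      have := mul_lt_mul_of_pos_left (h1.trans h2) hi
      exact ⟨this.le, fun _ => this⟩
  have := Finset.sum_lt_sum (fun i (_ : i ∈ Finset.univ) => (key i).1)
    ⟨i₀, Finset.mem_univ _, (key i₀).2 hi₀⟩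
  rw [hzero, hzero] at this
  exact lt_irrefl _ this

/-- A grid with more directions than the dimension is not separated in all of them. -/
theorem not_forall_isSeparated {d : ℕ} {α E : Type} [Finite α] [NormedAddCommGroup E]
    [NormedSpace ℝ E] [FiniteDimensional ℝ E] (hd : Module.finrank ℝ E = d)
    (x : (Fin (d + 1) → α) → E) (S : Fin (d + 1) → Finset α) (hS : ∀ c, 2 ≤ (S c).card) :
    ¬ ∀ i, IsSeparated x S i := by
  classical
  intro hsep
  choose b hb r hr hbr using fun c => Finset.one_lt_card.1 (hS c)
  have hcomp : ∀ i j, IsCompact (convexHull ℝ (x '' gridSlice S i j)) := fun i j =>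
    ((Set.toFinite (gridSlice S i j)).image x).isCompact_convexHull (𝕜 := ℝ)
  choose f u v hu huv hv using fun i => geometric_hahn_banach_compact_closed
    (convex_convexHull ℝ _) (hcomp i (b i)) (convex_convexHull ℝ _) (hcomp i (r i)).isClosed
    (hsep i _ (hb i) _ (hr i) (hbr i))
  refine not_forall_sign_pattern hd (fun i => (f i).toLinearMap) u fun σ => ?_
  have hmem : ∀ c, (if σ c then b c else r c) ∈ S c := fun c => by
    split_ifs
    exacts [hb c, hr c]
  refine ⟨x fun c => if σ c then b c else r c, fun i => ⟨fun hi => ?_, fun hi => ?_⟩⟩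
  · exact hu i _ (subset_convexHull ℝ _ ⟨_, ⟨hmem, by simp [hi]⟩, rfl⟩)
  · exact (huv i).trans (hv i _ (subset_convexHull ℝ _ ⟨_, ⟨hmem, by simp [hi]⟩, rfl⟩))

theorem addHaar_convexHull_insert_zero_basis_pos {ι E : Type*} [Fintype ι] [NormedAddCommGroup E]
    [NormedSpace ℝ E] [FiniteDimensional ℝ E] [MeasurableSpace E] [BorelSpace E] (μ : Measure E)
    [μ.IsAddHaarMeasure] (e : Module.Basis ι ℝ E) :
    0 < μ (convexHull ℝ (insert 0 (Set.range e))) := by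
  refine (isOpen_interior.measure_pos μ ?_).trans_le (measure_mono interior_subset)
  rw [interior_convexHull_nonempty_iff_affineSpan_eq_top]
  rw [← AffineSubspace.coe_eq_univ_iff, affineSpan_insert_zero, e.span_eq]
  rfl

theorem Module.Basis.det_constr {ι R M : Type*} [CommRing R] [AddCommGroup M] [Module R M]
    [Fintype ι] [DecidableEq ι] (e : Module.Basis ι R M) (v : ι → M) :
    LinearMap.det (e.constr R v) = e.det v := by
  have := Module.Basis.det_comp e (e.constr R v) e
  rw [e.det_self, mul_one] at this
  rw [← this]
  congr 1
  ext j
  simp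

/-- A convex set containing `p` and all `p + v j` has at least the measure of the simplex that
they span. -/
theorem ofReal_abs_det_mul_addHaar_le {ι E : Type*} [Fintype ι] [DecidableEq ι]
    [NormedAddCommGroup E] [NormedSpace ℝ E] [FiniteDimensional ℝ E] [MeasurableSpace E]
    [BorelSpace E] (μ : Measure E) [μ.IsAddHaarMeasure] (e : Module.Basis ι ℝ E) {I : Set E}
    (hI : Convex ℝ I) {p : E} {v : ι → E} (hp : p ∈ I) (hv : ∀ j, p + v j ∈ I) :
    ENNReal.ofReal |e.det v| * μ (convexHull ℝ (insert 0 (Set.range e))) ≤ μ I := by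
  rw [← e.det_constr, ← Measure.addHaar_image_linearMap μ, LinearMap.image_convexHull,
    ← measure_preimage_add μ (-p)]
  refine measure_mono fun y hy => ?_
  have : convexHull ℝ (e.constr ℝ v '' insert 0 (Set.range e)) ⊆ (fun z => p + z) ⁻¹' I := by
    refine convexHull_min ?_ (hI.translate_preimage_right p)
    rintro _ ⟨z, rfl | ⟨j, rfl⟩, rfl⟩
    · simpa using hp
    · simpa using hv j
  simpa using this hy

/-- A convex set of finite volume is contained in a set of comparable volume whose complement is a
union of boundedly many convex sets. -/
theorem exists_superset_addHaar_le {ι E : Type} [Fintype ι] [Nonempty ι]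
    [NormedAddCommGroup E] [NormedSpace ℝ E] [FiniteDimensional ℝ E] [MeasurableSpace E]
    [BorelSpace E] (μ : Measure E) [μ.IsAddHaarMeasure] (e : Module.Basis ι ℝ E) :
    ∃ C : NNReal, ∀ I : Set E, Convex ℝ I → μ I ≠ ⊤ →
      ∃ Q, I ⊆ Q ∧ μ Q ≤ C * μ I ∧ ∃ H : ι × Bool → Set E, (∀ k, Convex ℝ (H k)) ∧
        ⋃ k, H k = Qᶜ := by
  classical
  set Δ := convexHull ℝ (insert 0 (Set.range e))
  have hΔ : μ Δ ≠ 0 := (addHaar_convexHull_insert_zero_basis_pos μ e).ne'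
  set K : Set E := e.equivFunL.symm '' Set.univ.pi fun _ => Set.Icc (-2) 2
  have hK : μ K ≠ ⊤ := by
    refine IsCompact.measure_ne_top (IsCompact.image ?_ e.equivFunL.symm.continuous)
    exact isCompact_univ_pi fun _ => isCompact_Icc
  refine ⟨(μ K / μ Δ).toNNReal, fun I hI hfin => ?_⟩
  rw [ENNReal.coe_toNNReal (ENNReal.div_ne_top hK hΔ)]
  rcases (interior I).eq_empty_or_nonempty with hint | ⟨p₀, hp₀⟩
  · have hspan : affineSpan ℝ I ≠ ⊤ := fun h => by
      have := hI.interior_nonempty_iff_affineSpan_eq_top.2 h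
      simp [hint] at this
    obtain ⟨f, a, hf, hfI⟩ : ∃ (f : E →ₗ[ℝ] ℝ) (a : ℝ), f ≠ 0 ∧ I ⊆ {y | f y = a} := by
      rcases I.eq_empty_or_nonempty with rfl | ⟨p, hp⟩
      · exact ⟨e.coord (Classical.arbitrary ι), 0, fun h => by
          simpa using LinearMap.congr_fun h (e (Classical.arbitrary ι)), Set.empty_subset _⟩
      · have hdir : (affineSpan ℝ I).direction < ⊤ := by
          rw [lt_top_iff_ne_top]
          rwa [Ne, AffineSubspace.direction_eq_top_iff_of_nonempty ⟨p, subset_affineSpan ℝ I hp⟩]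
        obtain ⟨f, hf, hker⟩ := Submodule.exists_le_ker_of_lt_top _ hdir
        refine ⟨f, f p, hf, fun y hy => ?_⟩
        have := hker (AffineSubspace.vsub_mem_direction (subset_affineSpan ℝ I hy)
          (subset_affineSpan ℝ I hp))
        simpa [sub_eq_zero] using this
    refine ⟨{y | f y = a}, hfI, ?_, fun k => if k.2 then {y | f y < a} else {y | a < f y}, ?_, ?_⟩
    · have hnull : μ {y | f y = a} = 0 := by
        obtain ⟨w, hw⟩ : ∃ w, f w = a := LinearMap.surjective hf a
        have hset : {y | f y = a} = (AffineSubspace.mk' w (LinearMap.ker f) : Set E) := by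
          ext y
          simp [AffineSubspace.mem_mk', sub_eq_zero, hw]
        rw [hset]
        refine Measure.addHaar_affineSubspace μ _ fun h => hf ?_
        have := congrArg AffineSubspace.direction h
        rwa [AffineSubspace.direction_mk', AffineSubspace.direction_top,
          LinearMap.ker_eq_top] at this
      rw [hnull]
      exact zero_le
    · rintro ⟨j, b⟩
      cases b
      · simpa using convex_halfSpace_gt f.isLinear a
      · simpa using convex_halfSpace_lt f.isLinear a
    · ext y
      simp only [Set.mem_iUnion, Prod.exists, Bool.exists_bool]
      simp [or_comm, ← lt_or_lt_iff_ne]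
  · let V : Set ℝ := {t | ∃ p v, p ∈ I ∧ (∀ j, p + v j ∈ I) ∧ |e.det v| = t}
    have hV : BddAbove V := by
      refine ⟨(μ I / μ Δ).toReal, ?_⟩
      rintro _ ⟨p, v, hp, hv, rfl⟩
      rw [← ENNReal.ofReal_le_iff_le_toReal (ENNReal.div_ne_top hfin hΔ)]
      exact ENNReal.le_div_iff_mul_le (Or.inl hΔ) (Or.inr hfin) |>.2
        (ofReal_abs_det_mul_addHaar_le μ e hI hp hv)
    obtain ⟨t, htV, ht⟩ : ∃ t ∈ V, 0 < t := by
      obtain ⟨r, hr, hball⟩ : ∃ r : ℝ, 0 < r ∧ ∀ j, p₀ + r • e j ∈ I := by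
        have hev : ∀ᶠ r : ℝ in nhdsWithin 0 (Set.Ioi 0), ∀ j, p₀ + r • e j ∈ I := by
          refine Filter.eventually_all.2 fun j => nhdsWithin_le_nhds ?_
          have hc : ContinuousAt (fun r : ℝ => p₀ + r • e j) 0 := by fun_prop
          refine hc.preimage_mem_nhds ?_
          simpa using mem_interior_iff_mem_nhds.1 hp₀
        obtain ⟨r, hr, hr0⟩ := (hev.and self_mem_nhdsWithin).exists
        exact ⟨r, hr0, hr⟩
      refine ⟨_, ⟨p₀, fun j => r • e j, interior_subset hp₀, hball, rfl⟩, abs_pos.2 ?_⟩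
      have := e.det.map_smul_univ (fun _ => r) e
      rw [this, e.det_self]
      simpa using fun h => absurd h hr.ne'
    have hpos : 0 < sSup V := ht.trans_le (le_csSup hV htV)
    obtain ⟨_, ⟨p, v, hp, hv, rfl⟩, hlt⟩ := exists_lt_of_lt_csSup ⟨t, htV⟩ (half_lt_self hpos)
    have hdet : 0 < |e.det v| := (half_pos hpos).trans hlt
    obtain ⟨hli, hsp⟩ := (Module.Basis.is_basis_iff_det e).2 (abs_pos.1 hdet).isUnit
    set b := Module.Basis.mk hli hsp.ge
    have hb : ∀ j z, e.det v * b.coord j z = e.det (Function.update v j z) := fun j z =>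
      LinearMap.congr_fun (e.det_smul_mk_coord_eq_det_update hli hsp.ge j) z
    refine ⟨{y | ∀ j, |b.coord j (y - p)| ≤ 2}, fun y hy j => ?_, ?_,
      fun k => if k.2 then {y | b.coord k.1 y < b.coord k.1 p - 2} else
        {y | b.coord k.1 p + 2 < b.coord k.1 y}, ?_, ?_⟩
    · have hmem : |e.det (Function.update v j (y - p))| ∈ V := by
        refine ⟨p, _, hp, fun l => ?_, rfl⟩
        by_cases hl : l = j
        · subst hl; simpa using hy
        · simpa [hl] using hv l
      have := le_csSup hV hmem
      rw [← hb, abs_mul] at this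
      refine le_of_mul_le_mul_left ?_ hdet
      linarith
    · have hsub : {y | ∀ j, |b.coord j (y - p)| ≤ 2} ⊆
          (fun y => -p + y) ⁻¹' (e.constr ℝ v '' K) := by
        intro y hy
        refine ⟨_, ⟨fun j => b.coord j (y - p), fun j _ => abs_le.1 (hy j), rfl⟩, ?_⟩
        have hsum := b.sum_repr (y - p)
        simp only [b, Module.Basis.mk_apply] at hsum
        trans e.constr ℝ v (∑ j, b.coord j (y - p) • e j)
        · rw [← e.equivFun_symm_apply]; rfl
        rw [map_sum]
        simp only [map_smul, Module.Basis.constr_basis]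
        rw [neg_add_eq_sub]
        exact hsum
      refine (measure_mono hsub).trans ?_
      rw [measure_preimage_add, Measure.addHaar_image_linearMap, e.det_constr,
        ENNReal.mul_comm_div, mul_comm]
      exact mul_le_mul_right ((ENNReal.le_div_iff_mul_le (Or.inl hΔ) (Or.inr hfin)).2
        (ofReal_abs_det_mul_addHaar_le μ e hI hp hv)) _
    · rintro ⟨j, b'⟩
      cases b'
      · simpa using convex_halfSpace_gt (b.coord j).isLinear _
      · simpa using convex_halfSpace_lt (b.coord j).isLinear _
    · ext y
      simp only [Set.mem_iUnion, Prod.exists, Bool.exists_bool, Set.mem_compl_iff, Set.mem_ofPred_eq,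
        not_forall, not_le, map_sub, lt_abs]
      refine exists_congr fun j => ?_
      simp only [Bool.false_eq_true, if_false, if_true, Set.mem_ofPred_eq]
      constructor <;> rintro (h | h)
      · left; linarith
      · right; linarith
      · left; linarith
      · right; linarith

/-- Convex sets whose colorful intersections have measure at least `1` and whose `s`-fold
intersections have small measure admit points in all colorful intersections avoiding
the `s`-fold intersections. -/
theorem exists_hasConvexAvoidance {n N s : ℕ} {ι E : Type} [Fintype ι] [Nonempty ι]
    [NormedAddCommGroup E] [NormedSpace ℝ E] [FiniteDimensional ℝ E] [MeasurableSpace E]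
    [BorelSpace E] (μ : Measure E) [μ.IsAddHaarMeasure] (e : Module.Basis ι ℝ E) :
    ∃ δ > (0 : ℝ), ∀ A : Fin n → Fin N → Set E, (∀ i j, Convex ℝ (A i j)) →
      (∀ D : Fin n → Fin N, 1 ≤ μ (⋂ i, A i (D i))) →
      (∀ i (G : Finset (Fin N)), G.card = s → μ (⋂ j ∈ G, A i j) ≤ ENNReal.ofReal δ) →
      ∃ x : (Fin n → Fin N) → E, (∀ i D, x D ∈ A i (D i)) ∧
        ∀ i, HasConvexAvoidance (ι × Bool) s x (A i) := by
  obtain ⟨C, hC⟩ := exists_superset_addHaar_le μ e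
  set L : ℝ := n * 2 ^ N * C + 1
  have hL : 0 < L := by positivity
  refine ⟨L⁻¹, inv_pos.2 hL, fun A hA hbig hsmall => ?_⟩
  have hQ : ∀ (i : Fin n) (G : Finset (Fin N)), ∃ Q : Set E,
      μ Q ≤ C * ENNReal.ofReal L⁻¹ ∧ (G.card = s → ⋂ j ∈ G, A i j ⊆ Q ∧
        ∃ H : ι × Bool → Set E, (∀ k, Convex ℝ (H k)) ∧ ⋃ k, H k = Qᶜ) := by
    intro i G
    by_cases hG : G.card = s
    · obtain ⟨Q, hIQ, hμ, hH⟩ := hC (⋂ j ∈ G, A i j) (convex_iInter₂ fun j _ => hA i j)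
        ((hsmall i G hG).trans_lt ENNReal.ofReal_lt_top).ne
      exact ⟨Q, hμ.trans (mul_le_mul_right (hsmall i G hG) _), fun _ => ⟨hIQ, hH⟩⟩
    · exact ⟨∅, by simp, fun h => absurd h hG⟩
  choose Q hQμ hQI using hQ
  have htotal : μ (⋃ k : Fin n × Finset (Fin N), Q k.1 k.2) < 1 := by
    refine (measure_iUnion_fintype_le μ _).trans_lt
      ((Finset.sum_le_sum fun k _ => hQμ k.1 k.2).trans_lt ?_)
    rw [Finset.sum_const, Finset.card_univ, Fintype.card_prod, Fintype.card_finset,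
      Fintype.card_fin, Fintype.card_fin, nsmul_eq_mul, ← ENNReal.ofReal_coe_nnreal,
      ← ENNReal.ofReal_natCast, ← ENNReal.ofReal_mul (by positivity),
      ← ENNReal.ofReal_mul (by positivity), ENNReal.ofReal_lt_one, ← mul_assoc,
      ← div_eq_mul_inv, div_lt_one hL]
    push_cast
    exact lt_add_one _
  have hx : ∀ D : Fin n → Fin N, ∃ y, y ∈ ⋂ i, A i (D i) ∧ ∀ i G, y ∉ Q i G := by
    intro D
    by_contra! h
    refine (htotal.trans_le (hbig D)).not_ge (measure_mono fun y hy => ?_)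
    obtain ⟨i, G, hyQ⟩ := h y hy
    exact Set.mem_iUnion.2 ⟨(i, G), hyQ⟩
  choose x hxA hxQ using hx
  refine ⟨x, fun i D => Set.mem_iInter.1 (hxA D) i, fun i G hG => ?_⟩
  obtain ⟨hIQ, H, hH, hHQ⟩ := hQI i G hG
  refine ⟨H, hH, fun D => ?_, fun k => ?_⟩
  · rw [← Set.mem_iUnion, hHQ]
    exact hxQ D i G
  · refine Set.disjoint_iff_inter_eq_empty.1 (Set.disjoint_of_subset hIQ (Set.subset_iUnion H k) ?_)
    rw [hHQ]
    exact disjoint_compl_right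

/-- Weak Quantitative Colorful Helly theorem: rainbow tuples with small overlap parameter
have bounded size. -/
theorem weak_quantitative_colorful_helly (d s : ℕ) (hd : 0 < d) (hs : 0 < s) :
    ∃ N : ℕ, 0 < N ∧ ∃ δ > (0 : ℝ),
      ∀ m : ℕ, ∀ F : Fin (d + 1) → Finset (Set (EuclideanSpace ℝ (Fin d))),
        IsRainbow d m s 1 δ F → m < N := by
  classical
  obtain ⟨N, hN⟩ := exists_subgrid_forall_isSeparated hs (Fin d × Bool) 2
    (Finset.univ : Finset (Fin (d + 1)))
  have : Nonempty (Fin d) := ⟨⟨0, hd⟩⟩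
  obtain ⟨δ, hδ, hpoints⟩ := exists_hasConvexAvoidance (n := d + 1) (N := N) (s := s) volume
    (EuclideanSpace.basisFun (Fin d) ℝ).toBasis
  refine ⟨N + 1, N.succ_pos, δ, hδ, fun m F ⟨hconv, hcard, hcolorful, hoverlap⟩ => ?_⟩
  by_contra! hm
  have hinj : ∀ i, ∃ A : Fin N → Set (EuclideanSpace ℝ (Fin d)),
      Function.Injective A ∧ ∀ j, A j ∈ F i := fun i => by
    have hle : Fintype.card (Fin N) ≤ Fintype.card (F i) := by
      rw [Fintype.card_fin, Fintype.card_coe, hcard]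
      exact (Nat.le_succ N).trans hm
    obtain ⟨φ⟩ := Function.Embedding.nonempty_of_card_le hle
    exact ⟨fun j => φ j, Subtype.val_injective.comp φ.injective, fun j => (φ j).2⟩
  choose A hAinj hAF using hinj
  obtain ⟨x, hxA, havoid⟩ := hpoints A (fun i j => hconv i _ (hAF i j))
    (fun D => by simpa using hcolorful (fun i => A i (D i)) fun i => hAF i _)
    (fun i G hG => by
      have := hoverlap i (G.image (A i)) (Finset.image_subset_iff.2 fun j _ => hAF i j)
        (by rw [Finset.card_image_of_injective _ (hAinj i), hG])
      simpa [Set.sInter_image] using this)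
  obtain ⟨T, -, hT, hsep⟩ := hN (Fin N) _ x A (fun i j => hconv i _ (hAF i j)) hxA havoid
    (fun _ => Finset.univ) (fun _ => by simp)
  exact not_forall_isSeparated finrank_euclideanSpace_fin x T hT fun i => hsep i (Finset.mem_univ i)
end
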